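/- Let n ≥ 4 and let (u, p) be a smooth solution of the steady Navier-Stokes equations on ℝⁿ \ {0} satisfying |u(x)| ≤ C/|x| for all x ≠ 0 and some constant C. Then for every integer l ≥ 1 there is a constant C_l such that |∇^l u(x)| ≤ C_l/|x|^{1+l} and |∇^l p(x)| ≤ C_l/|x|^{2+l} for all x ≠ 0; moreover there is a constant c such that |p(x) − c| ≤ C₀/|x|² for all x ≠ 0. -/

import Mathlib

namespace SteadyNS

open MeasureTheory Metric Set Filter Topology
open scoped ContDiff

section DirDeriv

variable {E F : Type*} [NormedAddCommGroup E] [NormedSpace ℝ E]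
  [NormedAddCommGroup F] [NormedSpace ℝ F]

/-- The derivative of `f` in the direction `e`, as a function of the base point. -/
noncomputable def dirDeriv (e : E) (f : E → F) : E → F := fun x => fderiv ℝ f x e

theorem contDiff_dirDeriv {f : E → F} (hf : ContDiff ℝ ∞ f) (e : E) :
    ContDiff ℝ ∞ (dirDeriv e f) :=
  (hf.fderiv_right (m := ∞) (by simp)).clm_apply contDiff_const

theorem dirDeriv_comm {f : E → F} (hf : ContDiff ℝ ∞ f) (a b : E) :
    dirDeriv a (dirDeriv b f) = dirDeriv b (dirDeriv a f) := by
  have key : ∀ c d : E, ∀ x, dirDeriv c (dirDeriv d f) x = fderiv ℝ (fderiv ℝ f) x c d := by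
    intro c d x
    have h1 : DifferentiableAt ℝ (fderiv ℝ f) x :=
      (hf.fderiv_right (m := ∞) (by simp)).differentiable (by simp) x
    unfold dirDeriv
    rw [fderiv_clm_apply h1 (differentiableAt_const d)]
    simp
  funext x
  rw [key, key]
  have h2 : minSmoothness ℝ 2 ≤ (∞ : WithTop ℕ∞) := by
    rw [minSmoothness_of_isRCLikeNormedField]
    exact WithTop.coe_le_coe.2 le_top
  exact (hf.contDiffAt.isSymmSndFDerivAt h2) a b

theorem dirDeriv_sum {ι : Type*} {s : Finset ι} {f : ι → E → F}
    (hf : ∀ i, ContDiff ℝ ∞ (f i)) (e : E) :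
    dirDeriv e (fun x => ∑ i ∈ s, f i x) = fun x => ∑ i ∈ s, dirDeriv e (f i) x := by
  funext x
  unfold dirDeriv
  rw [fderiv_fun_sum fun i _ => (hf i).differentiable (by simp) x]
  simp

theorem dirDeriv_affine {f : E → F} (hf : ContDiff ℝ ∞ f) (e a : E) (s : ℝ) :
    dirDeriv e (fun y => f (a + s • y)) = fun y => s • dirDeriv e f (a + s • y) := by
  funext y
  have h1 : HasFDerivAt (fun y : E => a + s • y) (s • ContinuousLinearMap.id ℝ E) y :=
    ((hasFDerivAt_id y).const_smul s).const_add a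
  have h2 := (hf.differentiable (by simp) (a + s • y)).hasFDerivAt.comp y h1
  unfold dirDeriv
  rw [show (fun y => f (a + s • y)) = f ∘ (fun y : E => a + s • y) from rfl, h2.fderiv]
  simp

theorem contDiff_affine {f : E → F} (hf : ContDiff ℝ ∞ f) (a : E) (s : ℝ) :
    ContDiff ℝ ∞ (fun y => f (a + s • y)) :=
  hf.comp (contDiff_const.add (contDiff_const.smul contDiff_id))

theorem tsupport_dirDeriv_subset (f : E → F) (e : E) :
    tsupport (dirDeriv e f) ⊆ tsupport f :=
  tsupport_fderiv_apply_subset ℝ e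

theorem hasCompactSupport_dirDeriv {f : E → F} (hf : HasCompactSupport f) (e : E) :
    HasCompactSupport (dirDeriv e f) :=
  hf.of_isClosed_subset (isClosed_tsupport _) (tsupport_dirDeriv_subset f e)

end DirDeriv

section IntegrationByParts

theorem integrable_mul_of_compactSupport {E : Type*} [TopologicalSpace E] [MeasurableSpace E]
    [OpensMeasurableSpace E] {μ : Measure E} [IsFiniteMeasureOnCompacts μ] {f g : E → ℝ}
    (hf : Continuous f) (hg : Continuous g)
    (hgc : HasCompactSupport g) : Integrable (fun x => f x * g x) μ :=
  (hf.mul hg).integrable_of_hasCompactSupport hgc.mul_left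

theorem integral_mul_dirDeriv {E : Type*} [NormedAddCommGroup E] [NormedSpace ℝ E]
    [FiniteDimensional ℝ E] [MeasurableSpace E] [BorelSpace E] {μ : Measure E}
    [μ.IsAddHaarMeasure] {f g : E → ℝ} (hf : ContDiff ℝ ∞ f) (hg : ContDiff ℝ ∞ g)
    (hgc : HasCompactSupport g) (e : E) :
    ∫ x, f x * dirDeriv e g x ∂μ = -∫ x, dirDeriv e f x * g x ∂μ :=
  integral_mul_fderiv_eq_neg_fderiv_mul_of_integrable
    (integrable_mul_of_compactSupport (contDiff_dirDeriv hf e).continuous hg.continuous hgc)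
    (integrable_mul_of_compactSupport hf.continuous (contDiff_dirDeriv hg e).continuous
      (hasCompactSupport_dirDeriv hgc e))
    (integrable_mul_of_compactSupport hf.continuous hg.continuous hgc)
    (fun x _ => hf.differentiable (by simp) x) (fun x _ => hg.differentiable (by simp) x)

end IntegrationByParts

section Laplacian

variable {n : ℕ}

/-- The coordinate Laplacian `∑ i, ∂ᵢ∂ᵢ f`. -/
noncomputable def lap (f : EuclideanSpace ℝ (Fin n) → ℝ) : EuclideanSpace ℝ (Fin n) → ℝ :=
  fun x => ∑ i : Fin n, dirDeriv (EuclideanSpace.single i 1)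
    (dirDeriv (EuclideanSpace.single i 1) f) x

variable {f : EuclideanSpace ℝ (Fin n) → ℝ}

theorem contDiff_lap (hf : ContDiff ℝ ∞ f) : ContDiff ℝ ∞ (lap f) :=
  ContDiff.sum fun _ _ => contDiff_dirDeriv (contDiff_dirDeriv hf _) _

theorem dirDeriv_lap (hf : ContDiff ℝ ∞ f) (e : EuclideanSpace ℝ (Fin n)) :
    dirDeriv e (lap f) = lap (dirDeriv e f) := by
  unfold lap
  rw [dirDeriv_sum fun i => contDiff_dirDeriv (contDiff_dirDeriv hf _) _]
  funext x
  refine Finset.sum_congr rfl fun i _ => ?_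
  rw [dirDeriv_comm (contDiff_dirDeriv hf _), dirDeriv_comm hf]

theorem tsupport_lap_subset (f : EuclideanSpace ℝ (Fin n) → ℝ) :
    tsupport (lap f) ⊆ tsupport f := by
  refine closure_minimal (fun x hx => ?_) (isClosed_tsupport f)
  by_contra h
  refine hx (Finset.sum_eq_zero fun i _ => ?_)
  exact image_eq_zero_of_notMem_tsupport fun h' =>
    h (tsupport_dirDeriv_subset _ _ (tsupport_dirDeriv_subset _ _ h'))

theorem hasCompactSupport_lap (hf : HasCompactSupport f) : HasCompactSupport (lap f) :=
  hf.of_isClosed_subset (isClosed_tsupport _) (tsupport_lap_subset f)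

/-- If `a` is divergence free and `b` is curl free on the support of `ξ`, then pairing `a j` with
`Δξ` only sees `a - b`. -/
theorem integral_mul_lap_eq {a b : Fin n → EuclideanSpace ℝ (Fin n) → ℝ}
    {ξ : EuclideanSpace ℝ (Fin n) → ℝ} (ha : ∀ k, ContDiff ℝ ∞ (a k))
    (hb : ∀ k, ContDiff ℝ ∞ (b k)) (hξ : ContDiff ℝ ∞ ξ) (hξc : HasCompactSupport ξ)
    (hcurl : ∀ i j, dirDeriv (EuclideanSpace.single i 1) (b j) =
      dirDeriv (EuclideanSpace.single j 1) (b i))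
    (hdiv : ∀ x ∈ tsupport ξ, ∑ k, dirDeriv (EuclideanSpace.single k 1) (a k) x = 0)
    (j : Fin n) :
    ∫ x, a j x * lap ξ x = (∫ x, (a j x - b j x) * lap ξ x) -
      ∑ k, ∫ x, (a k x - b k x) * dirDeriv (EuclideanSpace.single k 1)
        (dirDeriv (EuclideanSpace.single j 1) ξ) x := by
  have hD : ∀ e, ContDiff ℝ ∞ (dirDeriv e ξ) := contDiff_dirDeriv hξ
  have hDc : ∀ e, HasCompactSupport (dirDeriv e ξ) := hasCompactSupport_dirDeriv hξc
  have hDD : ∀ e e', ContDiff ℝ ∞ (dirDeriv e (dirDeriv e' ξ)) :=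
    fun e e' => contDiff_dirDeriv (hD e') e
  have hDDc : ∀ e e', HasCompactSupport (dirDeriv e (dirDeriv e' ξ)) :=
    fun e e' => hasCompactSupport_dirDeriv (hDc e') e
  have hI : ∀ {f : EuclideanSpace ℝ (Fin n) → ℝ}, ContDiff ℝ ∞ f → ∀ e e',
      Integrable (fun x => f x * dirDeriv e (dirDeriv e' ξ) x) := fun hf e e' =>
    integrable_mul_of_compactSupport hf.continuous (hDD e e').continuous (hDDc e e')
  have hIl : ∀ {f : EuclideanSpace ℝ (Fin n) → ℝ}, ContDiff ℝ ∞ f →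
      Integrable (fun x => f x * lap ξ x) := fun hf =>
    integrable_mul_of_compactSupport hf.continuous (contDiff_lap hξ).continuous
      (hasCompactSupport_lap hξc)
  have hb_int : ∫ x, b j x * lap ξ x = ∑ k, ∫ x, b k x *
      dirDeriv (EuclideanSpace.single k 1) (dirDeriv (EuclideanSpace.single j 1) ξ) x := by
    simp only [lap, Finset.mul_sum]
    rw [integral_finsetSum _ fun k _ => hI (hb j) _ _]
    refine Finset.sum_congr rfl fun k _ => ?_
    rw [integral_mul_dirDeriv (hb j) (hD _) (hDc _), hcurl k j, dirDeriv_comm hξ,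
      integral_mul_dirDeriv (hb k) (hD _) (hDc _)]
  have ha_int : ∑ k, ∫ x, a k x *
      dirDeriv (EuclideanSpace.single k 1) (dirDeriv (EuclideanSpace.single j 1) ξ) x = 0 := by
    have : ∀ k, ∫ x, a k x *
        dirDeriv (EuclideanSpace.single k 1) (dirDeriv (EuclideanSpace.single j 1) ξ) x =
        -∫ x, dirDeriv (EuclideanSpace.single k 1) (a k) x *
          dirDeriv (EuclideanSpace.single j 1) ξ x := fun k =>
      integral_mul_dirDeriv (ha k) (hD _) (hDc _) _
    simp only [this]
    rw [Finset.sum_neg_distrib, ← integral_finsetSum _ fun k _ =>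
      integrable_mul_of_compactSupport (contDiff_dirDeriv (ha k) _).continuous
        (hD _).continuous (hDc _), neg_eq_zero]
    refine integral_eq_zero_of_ae (Eventually.of_forall fun x => ?_)
    simp only [Pi.zero_apply]
    rw [← Finset.sum_mul]
    by_cases hx : x ∈ tsupport ξ
    · rw [hdiv x hx, zero_mul]
    · rw [image_eq_zero_of_notMem_tsupport fun h => hx (tsupport_dirDeriv_subset _ _ h), mul_zero]
  simp only [sub_mul]
  rw [integral_sub (hIl (ha j)) (hIl (hb j)), hb_int]
  rw [Finset.sum_congr rfl fun k _ => integral_sub (hI (ha k) _ _) (hI (hb k) _ _),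
    Finset.sum_sub_distrib, ha_int]
  ring

theorem abs_integral_mul_le {F g : EuclideanSpace ℝ (Fin n) → ℝ} {N : ℝ}
    (hg : Continuous g) (hgc : HasCompactSupport g)
    (hF : ∀ x ∈ tsupport g, |F x| ≤ N) :
    |∫ x, F x * g x| ≤ N * ∫ x, |g x| := by
  rw [← integral_const_mul, ← Real.norm_eq_abs]
  refine norm_integral_le_of_norm_le
    ((hg.abs.integrable_of_hasCompactSupport hgc.norm).const_mul N)
    (Eventually.of_forall fun x => ?_)
  rw [Real.norm_eq_abs, abs_mul]
  by_cases hx : x ∈ tsupport g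
  · exact mul_le_mul_of_nonneg_right (hF x hx) (abs_nonneg _)
  · simp [image_eq_zero_of_notMem_tsupport hx]

end Laplacian

section Profile

/-- The radial cutoff profile: `1` for `t ≤ 0` and `0` for `1 ≤ t`. -/
noncomputable def cutoff (t : ℝ) : ℝ := Real.smoothTransition (1 - t)

theorem contDiff_cutoff : ContDiff ℝ ∞ cutoff :=
  Real.smoothTransition.contDiff.comp (contDiff_const.sub contDiff_id)

theorem cutoff_of_one_le {t : ℝ} (ht : 1 ≤ t) : cutoff t = 0 :=
  Real.smoothTransition.zero_of_nonpos (by linarith)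

theorem cutoff_zero : cutoff 0 = 1 := Real.smoothTransition.one_of_one_le (by simp)

theorem antitone_cutoff : Antitone cutoff := fun _ _ h =>
  Real.smoothTransition.monotone (by linarith)

theorem contDiff_deriv {f : ℝ → ℝ} (hf : ContDiff ℝ ∞ f) : ContDiff ℝ ∞ (deriv f) :=
  (contDiff_infty_iff_deriv.1 hf).2

theorem deriv_eq_zero_of_one_lt {f : ℝ → ℝ} (hf : ∀ t, 1 < t → f t = 0) {t : ℝ} (ht : 1 < t) :
    deriv f t = 0 := by
  have : f =ᶠ[𝓝 t] fun _ => 0 := by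
    filter_upwards [lt_mem_nhds ht] with s hs using hf s hs
  rw [this.deriv_eq, deriv_const]

variable {n : ℕ}

theorem hasFDerivAt_radial {f : ℝ → ℝ} (hf : ContDiff ℝ ∞ f) (x : EuclideanSpace ℝ (Fin n)) :
    HasFDerivAt (fun y : EuclideanSpace ℝ (Fin n) => f (‖y‖ ^ 2))
      (deriv f (‖x‖ ^ 2) • (2 • (innerSL ℝ x))) x :=
  (hf.differentiable (by simp) _).hasDerivAt.comp_hasFDerivAt x
    (hasStrictFDerivAt_norm_sq x).hasFDerivAt

theorem contDiff_radial {f : ℝ → ℝ} (hf : ContDiff ℝ ∞ f) :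
    ContDiff ℝ ∞ (fun y : EuclideanSpace ℝ (Fin n) => f (‖y‖ ^ 2)) :=
  hf.comp (contDiff_norm_sq ℝ)

theorem dirDeriv_radial {f : ℝ → ℝ} (hf : ContDiff ℝ ∞ f) (i : Fin n)
    (x : EuclideanSpace ℝ (Fin n)) :
    dirDeriv (EuclideanSpace.single i 1) (fun y : EuclideanSpace ℝ (Fin n) => f (‖y‖ ^ 2)) x =
      x i * (2 * deriv f (‖x‖ ^ 2)) := by
  unfold dirDeriv
  rw [(hasFDerivAt_radial hf x).fderiv]
  simp [EuclideanSpace.inner_single_right]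
  ring

/-- The Laplacian of `h (‖x‖²)` is `lapProfile n h (‖x‖²)`. -/
noncomputable def lapProfile (n : ℕ) (h : ℝ → ℝ) (t : ℝ) : ℝ :=
  4 * t * deriv (deriv h) t + 2 * n * deriv h t

theorem contDiff_lapProfile {h : ℝ → ℝ} (hh : ContDiff ℝ ∞ h) : ContDiff ℝ ∞ (lapProfile n h) :=
  ((contDiff_const.mul contDiff_id).mul (contDiff_deriv (contDiff_deriv hh))).add
    (contDiff_const.mul (contDiff_deriv hh))

theorem lap_radial {h : ℝ → ℝ} (hh : ContDiff ℝ ∞ h) :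
    lap (fun y : EuclideanSpace ℝ (Fin n) => h (‖y‖ ^ 2)) =
      fun x => lapProfile n h (‖x‖ ^ 2) := by
  funext x
  have hh' := contDiff_deriv hh
  have h1 : ∀ i : Fin n, dirDeriv (EuclideanSpace.single i 1)
      (dirDeriv (EuclideanSpace.single i 1)
        (fun y : EuclideanSpace ℝ (Fin n) => h (‖y‖ ^ 2))) x =
      2 * deriv h (‖x‖ ^ 2) + (x i) ^ 2 * (4 * deriv (deriv h) (‖x‖ ^ 2)) := by
    intro i
    rw [show dirDeriv (EuclideanSpace.single i 1)
        (fun y : EuclideanSpace ℝ (Fin n) => h (‖y‖ ^ 2)) =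
        fun y => y i * (2 * deriv h (‖y‖ ^ 2)) from funext (dirDeriv_radial hh i)]
    have h2 : HasFDerivAt (fun y : EuclideanSpace ℝ (Fin n) => y i)
        (EuclideanSpace.proj (𝕜 := ℝ) i : EuclideanSpace ℝ (Fin n) →L[ℝ] ℝ) x :=
      (EuclideanSpace.proj (𝕜 := ℝ) i).hasFDerivAt
    have h3 := h2.fun_mul ((hasFDerivAt_radial hh' x).const_mul 2)
    unfold dirDeriv
    rw [h3.fderiv]
    simp [EuclideanSpace.inner_single_right]
    ring
  simp only [lap, h1, Finset.sum_add_distrib, ← Finset.sum_mul, lapProfile]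
  rw [EuclideanSpace.norm_sq_eq]
  simp
  ring

theorem lapProfile_eq_zero {h : ℝ → ℝ} (hh : ∀ t, 1 < t → h t = 0) {t : ℝ} (ht : 1 < t) :
    lapProfile n h t = 0 := by
  have h1 : ∀ t, 1 < t → deriv h t = 0 := fun t ht => deriv_eq_zero_of_one_lt hh ht
  rw [lapProfile, h1 t ht, deriv_eq_zero_of_one_lt h1 ht]
  ring

theorem integral_Ioi_deriv_lapProfile (hn : 4 ≤ n) {h : ℝ → ℝ} (hh : ContDiff ℝ ∞ h)
    (hsupp : ∀ t, 1 < t → h t = 0) :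
    ∫ r in Ioi (0 : ℝ), r ^ (n - 1) • (2 * deriv (lapProfile n h) (r ^ 2)) =
      -(4 * (n - 2)) * ∫ r in (0 : ℝ)..2, r ^ (n - 3) * deriv h (r ^ 2) := by
  obtain ⟨m, rfl⟩ : ∃ m, n = m + 4 := ⟨n - 4, by omega⟩
  set H := lapProfile (m + 4) h with hH
  have hHs : ContDiff ℝ ∞ H := contDiff_lapProfile hh
  have hh' := contDiff_deriv hh
  have hH0 : ∀ t, 1 < t → deriv H t = 0 := fun t ht =>
    deriv_eq_zero_of_one_lt (fun t ht => lapProfile_eq_zero hsupp ht) ht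
  have hd : ∀ r : ℝ, HasDerivAt
      (fun r : ℝ => r ^ (m + 2) * H (r ^ 2) - (m + 2) * r ^ (m + 1) * (2 * r * deriv h (r ^ 2)))
      (r ^ (m + 3) * (2 * deriv H (r ^ 2)) +
        4 * (m + 2) * (r ^ (m + 1) * deriv h (r ^ 2))) r := by
    intro r
    have hsq : HasDerivAt (fun r : ℝ => r ^ 2) (2 * r) r := by simpa using hasDerivAt_pow 2 r
    have e1 : HasDerivAt (fun r : ℝ => H (r ^ 2)) (deriv H (r ^ 2) * (2 * r)) r :=
      HasDerivAt.comp (h₂ := H) r (hHs.differentiable (by simp) (r ^ 2)).hasDerivAt hsq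
    have e2 : HasDerivAt (fun r : ℝ => deriv h (r ^ 2)) (deriv (deriv h) (r ^ 2) * (2 * r)) r :=
      HasDerivAt.comp (h₂ := deriv h) r (hh'.differentiable (by simp) (r ^ 2)).hasDerivAt hsq
    have e3 := ((hasDerivAt_pow (m + 2) r).mul e1).sub
      (((hasDerivAt_pow (m + 1) r).const_mul ((m : ℝ) + 2)).mul
        (((hasDerivAt_id r).const_mul 2).mul e2))
    convert! e3 using 1
    simp only [hH, lapProfile]
    push_cast
    simp
    ring
  have hc1 : Continuous fun r : ℝ => r ^ (m + 3) * (2 * deriv H (r ^ 2)) :=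
    (continuous_pow _).mul (continuous_const.mul
      ((contDiff_deriv hHs).continuous.comp (continuous_pow 2)))
  have hc2 : Continuous fun r : ℝ => r ^ (m + 1) * deriv h (r ^ 2) :=
    (continuous_pow _).mul (hh'.continuous.comp (continuous_pow 2))
  have hc3 : Continuous fun r : ℝ => 4 * ((m : ℝ) + 2) * (r ^ (m + 1) * deriv h (r ^ 2)) :=
    continuous_const.mul hc2
  have hFTC := intervalIntegral.integral_eq_sub_of_hasDerivAt (a := 0) (b := 2)
    (fun r _ => hd r) ((hc1.add hc3).intervalIntegrable _ _)
  rw [intervalIntegral.integral_add (hc1.intervalIntegrable _ _)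
    (hc3.intervalIntegrable _ _),
    intervalIntegral.integral_const_mul] at hFTC
  have hb : H (2 ^ 2) = 0 := lapProfile_eq_zero hsupp (by norm_num)
  have hb' : deriv h (2 ^ 2) = 0 := deriv_eq_zero_of_one_lt hsupp (by norm_num)
  rw [hb, hb'] at hFTC
  have hIoi : ∫ r in Ioi (0 : ℝ), r ^ (m + 4 - 1) • (2 * deriv H (r ^ 2)) =
      ∫ r in (0 : ℝ)..2, r ^ (m + 3) * (2 * deriv H (r ^ 2)) := by
    rw [intervalIntegral.integral_of_le (by norm_num)]
    refine (setIntegral_eq_of_subset_of_forall_sdiff_eq_zero measurableSet_Ioi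
      Ioc_subset_Ioi_self ?_)
    intro r hr
    have h2 : 2 < r := by
      by_contra h'
      exact hr.2 ⟨hr.1, not_lt.1 h'⟩
    simp [hH0 (r ^ 2) (by nlinarith)]
  rw [hIoi]
  simp only [show m + 4 - 3 = m + 1 by omega]
  push_cast
  simp at hFTC
  linarith

theorem integral_pow_mul_deriv_cutoff_neg (k : ℕ) :
    ∫ r in (0 : ℝ)..2, r ^ k * deriv cutoff (r ^ 2) < 0 := by
  have hle : ∀ t, deriv cutoff t ≤ 0 := fun t => antitone_cutoff.deriv_nonpos
  obtain ⟨c, hc, hc'⟩ := exists_deriv_eq_slope cutoff (zero_lt_one' ℝ)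
    contDiff_cutoff.continuous.continuousOn
    (contDiff_cutoff.differentiable (by simp)).differentiableOn
  rw [cutoff_of_one_le le_rfl, cutoff_zero] at hc'
  have hcont : Continuous fun r : ℝ => -(r ^ k * deriv cutoff (r ^ 2)) :=
    ((continuous_pow _).mul
      ((contDiff_deriv contDiff_cutoff).continuous.comp (continuous_pow 2))).neg
  have hpos : 0 < ∫ r in (0 : ℝ)..2, -(r ^ k * deriv cutoff (r ^ 2)) := by
    refine intervalIntegral.integral_pos (by norm_num) hcont.continuousOn ?_ ?_
    · intro r hr
      have := mul_nonneg (pow_nonneg hr.1.le k) (neg_nonneg.2 (hle (r ^ 2)))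
      linarith
    · refine ⟨√c, ⟨Real.sqrt_nonneg _, ?_⟩, ?_⟩
      · exact (Real.sqrt_le_one.2 hc.2.le).trans (by norm_num)
      · rw [Real.sq_sqrt hc.1.le, hc']
        have := pow_pos (Real.sqrt_pos.2 hc.1) k
        norm_num
        exact this
  rw [intervalIntegral.integral_neg] at hpos
  linarith

theorem tsupport_radial_subset {f : ℝ → ℝ} (hf : ∀ t, 1 < t → f t = 0) :
    tsupport (fun y : EuclideanSpace ℝ (Fin n) => f (‖y‖ ^ 2)) ⊆ closedBall 0 1 := by
  refine closure_minimal (fun x hx => ?_) isClosed_closedBall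
  by_contra h
  rw [mem_closedBall_zero_iff, not_le] at h
  exact hx (hf _ (by nlinarith))

/-- A pair `(φ, ψ)` of test functions with `∫ φ = 1` and `y φ(y) = ∇Δψ(y)`: the averages against
the dilates of `φ` then vary by averages of the bilaplacian against dilates of `ψ`. -/
theorem exists_profile (hn : 4 ≤ n) : ∃ φ ψ : EuclideanSpace ℝ (Fin n) → ℝ,
    ContDiff ℝ ∞ φ ∧ ContDiff ℝ ∞ ψ ∧ tsupport φ ⊆ closedBall 0 1 ∧
    tsupport ψ ⊆ closedBall 0 1 ∧ ∫ y, φ y = 1 ∧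
    ∀ i y, dirDeriv (EuclideanSpace.single i 1) (lap ψ) y = y i * φ y := by
  set H := lapProfile n cutoff
  have hcut : ∀ t, 1 < t → cutoff t = 0 := fun t ht => cutoff_of_one_le ht.le
  have hHs : ContDiff ℝ ∞ H := contDiff_lapProfile contDiff_cutoff
  set I := ∫ y : EuclideanSpace ℝ (Fin n), 2 * deriv H (‖y‖ ^ 2) with hI
  have hI0 : I ≠ 0 := by
    have : Nontrivial (EuclideanSpace ℝ (Fin n)) :=
      Module.nontrivial_of_finrank_pos (R := ℝ) (by simp; omega)
    rw [hI, integral_fun_norm_addHaar volume fun r => 2 * deriv H (r ^ 2)]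
    rw [finrank_euclideanSpace_fin, integral_Ioi_deriv_lapProfile hn contDiff_cutoff hcut]
    have h1 := integral_pow_mul_deriv_cutoff_neg (n - 3)
    have h2 : 0 < volume.real (ball (0 : EuclideanSpace ℝ (Fin n)) 1) :=
      ENNReal.toReal_pos (measure_ball_pos _ _ one_pos).ne' measure_ball_lt_top.ne
    have h3 : (4 : ℝ) ≤ n := by exact_mod_cast hn
    have h4 : 0 < (4 * ((n : ℝ) - 2)) := by linarith
    simp only [nsmul_eq_mul, smul_eq_mul]
    have h5 : (n : ℝ) ≠ 0 := by linarith
    exact mul_ne_zero h5 (mul_ne_zero h2.ne' (mul_ne_zero (neg_ne_zero.2 h4.ne') h1.ne))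
  have hdH : ∀ t, 1 < t → I⁻¹ * (2 * deriv H t) = 0 := fun t ht => by
    rw [deriv_eq_zero_of_one_lt (fun t ht => lapProfile_eq_zero hcut ht) ht]
    simp
  have hcs : ContDiff ℝ ∞ fun t => I⁻¹ * cutoff t := contDiff_const.mul contDiff_cutoff
  refine ⟨fun y => I⁻¹ * (2 * deriv H (‖y‖ ^ 2)), fun y => I⁻¹ * cutoff (‖y‖ ^ 2),
    contDiff_radial (f := fun t => I⁻¹ * (2 * deriv H t))
      (contDiff_const.mul (contDiff_const.mul (contDiff_deriv hHs))),
    contDiff_radial hcs, tsupport_radial_subset hdH,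
    tsupport_radial_subset (f := fun t => I⁻¹ * cutoff t) fun t ht => by simp [hcut t ht], ?_, ?_⟩
  · rw [integral_const_mul, ← hI, inv_mul_cancel₀ hI0]
  · intro i y
    have hp : lapProfile n (fun t => I⁻¹ * cutoff t) = fun t => I⁻¹ * H t := by
      have e1 : deriv (fun t => I⁻¹ * cutoff t) = fun t => I⁻¹ * deriv cutoff t :=
        funext fun t => deriv_const_mul_field _
      have e2 : deriv (fun t => I⁻¹ * deriv cutoff t) = fun t => I⁻¹ * deriv (deriv cutoff) t :=
        funext fun t => deriv_const_mul_field _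
      funext t
      simp only [lapProfile, e1, e2, H]
      ring
    rw [lap_radial hcs, hp, dirDeriv_radial (f := fun t => I⁻¹ * H t) (contDiff_const.mul hHs),
      deriv_const_mul_field]
    ring

end Profile

section InteriorEstimate

variable {n : ℕ}

theorem hasDerivAt_average {f φ : EuclideanSpace ℝ (Fin n) → ℝ} (hf : ContDiff ℝ ∞ f)
    (hφ : Continuous φ) (hφs : tsupport φ ⊆ closedBall 0 1)
    (x₀ : EuclideanSpace ℝ (Fin n)) (s : ℝ) :
    HasDerivAt (fun s => ∫ y, f (x₀ + s • y) * φ y)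
      (∫ y, fderiv ℝ f (x₀ + s • y) y * φ y) s := by
  have hc : Continuous fun z : ℝ × EuclideanSpace ℝ (Fin n) =>
      fderiv ℝ f (x₀ + z.1 • z.2) z.2 * φ z.2 :=
    (((hf.continuous_fderiv (by simp)).comp (by fun_prop)).clm_apply continuous_snd).mul
      (hφ.comp continuous_snd)
  have hφc : HasCompactSupport φ :=
    (isCompact_closedBall _ _).of_isClosed_subset (isClosed_tsupport _) hφs
  obtain ⟨B, hB⟩ := ((isCompact_closedBall s 1).prod
    (isCompact_closedBall (0 : EuclideanSpace ℝ (Fin n)) 1)).exists_bound_of_continuousOn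
    hc.continuousOn
  have hi : ∀ s : ℝ, Integrable fun y => f (x₀ + s • y) * φ y := fun s =>
    integrable_mul_of_compactSupport (hf.continuous.comp (by fun_prop)) hφ hφc
  refine (hasDerivAt_integral_of_dominated_loc_of_deriv_le
    (F' := fun s y => fderiv ℝ f (x₀ + s • y) y * φ y)
    (bound := (closedBall (0 : EuclideanSpace ℝ (Fin n)) 1).indicator fun _ => B)
    (closedBall_mem_nhds s one_pos) (Eventually.of_forall fun s => (hi s).aestronglyMeasurable)
    (hi s) ?_ ?_ ?_ ?_).2
  · exact (hc.comp (continuous_const.prodMk continuous_id)).aestronglyMeasurable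
  · refine Eventually.of_forall fun y t ht => ?_
    by_cases hy : y ∈ closedBall (0 : EuclideanSpace ℝ (Fin n)) 1
    · rw [indicator_of_mem hy]
      exact hB (t, y) ⟨ht, hy⟩
    · rw [image_eq_zero_of_notMem_tsupport fun h => hy (hφs h)]
      simp [indicator_of_notMem hy]
  · rw [integrable_indicator_iff measurableSet_closedBall]
    exact integrableOn_const measure_closedBall_lt_top.ne
  · refine Eventually.of_forall fun y t _ => ?_
    have h1 : HasDerivAt (fun t : ℝ => x₀ + t • y) y t := by
      simpa using ((hasDerivAt_id t).smul_const y).const_add x₀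
    exact ((hf.differentiable (by simp) (x₀ + t • y)).hasFDerivAt.comp_hasDerivAt t h1).mul_const
      (φ y)

theorem fderiv_apply_eq_sum (f : EuclideanSpace ℝ (Fin n) → ℝ) (x v : EuclideanSpace ℝ (Fin n)) :
    fderiv ℝ f x v = ∑ i, v i * dirDeriv (EuclideanSpace.single i 1) f x := by
  conv_lhs => rw [← (EuclideanSpace.basisFun (Fin n) ℝ).sum_repr v]
  simp [dirDeriv]

/-- Averages of `∂ₑ f` against dilates of `φ` have derivative given by `Δ f` tested against
`Δ∂ₑ ψ`, for a pair `(φ, ψ)` as in `exists_profile`. -/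
theorem integral_fderiv_dirDeriv_mul {f φ ψ : EuclideanSpace ℝ (Fin n) → ℝ}
    (hf : ContDiff ℝ ∞ f) (hψ : ContDiff ℝ ∞ ψ) (hψc : HasCompactSupport ψ)
    (hφψ : ∀ i y, dirDeriv (EuclideanSpace.single i 1) (lap ψ) y = y i * φ y)
    (x₀ e : EuclideanSpace ℝ (Fin n)) (s : ℝ) :
    ∫ y, fderiv ℝ (dirDeriv e f) (x₀ + s • y) y * φ y =
      ∫ y, lap f (x₀ + s • y) * lap (dirDeriv e ψ) y := by
  have hχ : ContDiff ℝ ∞ (lap ψ) := contDiff_lap hψ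
  have hχc : HasCompactSupport (lap ψ) := hasCompactSupport_lap hψc
  have hfe : ContDiff ℝ ∞ (dirDeriv e f) := contDiff_dirDeriv hf e
  have hτ : ∀ {g : EuclideanSpace ℝ (Fin n) → ℝ}, ContDiff ℝ ∞ g →
      ContDiff ℝ ∞ fun y => g (x₀ + s • y) := fun hg => contDiff_affine hg x₀ s
  have hint : ∀ i : Fin n, Integrable fun y => s • dirDeriv (EuclideanSpace.single i 1)
      (dirDeriv (EuclideanSpace.single i 1) (dirDeriv e f)) (x₀ + s • y) * lap ψ y := fun i =>
    integrable_mul_of_compactSupport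
      ((hτ (contDiff_dirDeriv (contDiff_dirDeriv hfe _) _)).continuous.const_smul s)
      hχ.continuous hχc
  have h1 : ∀ y, fderiv ℝ (dirDeriv e f) (x₀ + s • y) y * φ y =
      ∑ i, dirDeriv (EuclideanSpace.single i 1) (dirDeriv e f) (x₀ + s • y) *
        dirDeriv (EuclideanSpace.single i 1) (lap ψ) y := by
    intro y
    rw [fderiv_apply_eq_sum, Finset.sum_mul]
    refine Finset.sum_congr rfl fun i _ => ?_
    rw [hφψ]
    ring
  simp only [h1]
  rw [integral_finsetSum _ fun i _ => integrable_mul_of_compactSupport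
    (hτ (contDiff_dirDeriv hfe _)).continuous (contDiff_dirDeriv hχ _).continuous
    (hasCompactSupport_dirDeriv hχc _)]
  simp only [integral_mul_dirDeriv (hτ (contDiff_dirDeriv hfe _)) hχ hχc,
    dirDeriv_affine (contDiff_dirDeriv hfe _)]
  rw [Finset.sum_neg_distrib, ← integral_finsetSum _ fun i _ => hint i, ← dirDeriv_lap hψ,
    integral_mul_dirDeriv (hτ (contDiff_lap hf)) hχ hχc,
    dirDeriv_affine (contDiff_lap hf), dirDeriv_lap hf]
  simp only [← Finset.sum_mul, ← Finset.smul_sum, lap]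

theorem integral_abs_dirDeriv_le {f : EuclideanSpace ℝ (Fin n) → ℝ} (hf : ContDiff ℝ ∞ f)
    (hfc : HasCompactSupport f) (e : EuclideanSpace ℝ (Fin n)) :
    ∫ y, |dirDeriv e f y| ≤ ‖e‖ * ∫ y, ‖fderiv ℝ f y‖ := by
  rw [← integral_const_mul]
  refine integral_mono ((contDiff_dirDeriv hf e).continuous.abs.integrable_of_hasCompactSupport
    (hasCompactSupport_dirDeriv hfc e).norm)
    (((hf.continuous_fderiv (by simp)).norm.integrable_of_hasCompactSupport
      (hfc.fderiv ℝ).norm).const_mul _) fun y => ?_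
  rw [mul_comm]
  exact (fderiv ℝ f y).le_opNorm e

theorem sum_dirDeriv_lap_eq_zero {v : Fin n → EuclideanSpace ℝ (Fin n) → ℝ}
    (hv : ∀ j, ContDiff ℝ ∞ (v j)) {x : EuclideanSpace ℝ (Fin n)}
    (hdiv : ∀ᶠ y in 𝓝 x, ∑ i, dirDeriv (EuclideanSpace.single i 1) (v i) y = 0) :
    ∑ k, dirDeriv (EuclideanSpace.single k 1) (lap (v k)) x = 0 := by
  have hd : ∀ k, ContDiff ℝ ∞ (dirDeriv (EuclideanSpace.single k 1) (v k)) := fun k =>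
    contDiff_dirDeriv (hv k) _
  set D : EuclideanSpace ℝ (Fin n) → ℝ := fun x =>
    ∑ k, dirDeriv (EuclideanSpace.single k 1) (v k) x with hD
  have hDlap : ∑ k, dirDeriv (EuclideanSpace.single k 1) (lap (v k)) x = lap D x := by
    have h1 : ∀ i : Fin n, dirDeriv (EuclideanSpace.single i 1)
        (dirDeriv (EuclideanSpace.single i 1) D) x = ∑ k, dirDeriv (EuclideanSpace.single i 1)
          (dirDeriv (EuclideanSpace.single i 1)
            (dirDeriv (EuclideanSpace.single k 1) (v k))) x := by
      intro i
      rw [hD, dirDeriv_sum hd, dirDeriv_sum fun k => contDiff_dirDeriv (hd k) _]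
    simp only [lap, h1]
    rw [Finset.sum_comm]
    refine Finset.sum_congr rfl fun k _ => ?_
    exact congrFun (dirDeriv_lap (hv k) _) x
  have hD0 : D =ᶠ[𝓝 x] fun _ => 0 := hdiv
  rw [hDlap]
  refine Finset.sum_eq_zero fun i _ => ?_
  have h2 : dirDeriv (EuclideanSpace.single i 1) D =ᶠ[𝓝 x] fun _ => 0 := by
    filter_upwards [hD0.eventuallyEq_nhds] with z hz
    simp [dirDeriv, hz.fderiv_eq]
  simp [dirDeriv, h2.fderiv_eq]

theorem abs_integral_lap_mul_lap_le {v : Fin n → EuclideanSpace ℝ (Fin n) → ℝ}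
    {q ψ : EuclideanSpace ℝ (Fin n) → ℝ} (hv : ∀ j, ContDiff ℝ ∞ (v j)) (hq : ContDiff ℝ ∞ q)
    (hψ : ContDiff ℝ ∞ ψ) (hψc : HasCompactSupport ψ) {x₀ : EuclideanSpace ℝ (Fin n)} {s N : ℝ}
    (hN : 0 ≤ N) (hvN : ∀ y ∈ tsupport ψ, ∀ k, |lap (v k) (x₀ + s • y) -
      dirDeriv (EuclideanSpace.single k 1) q (x₀ + s • y)| ≤ N)
    (hdiv : ∀ y ∈ tsupport ψ, ∀ᶠ z in 𝓝 (x₀ + s • y),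
      ∑ i, dirDeriv (EuclideanSpace.single i 1) (v i) z = 0)
    (j : Fin n) (e : EuclideanSpace ℝ (Fin n)) :
    |∫ y, lap (v j) (x₀ + s • y) * lap (dirDeriv e ψ) y| ≤
      N * ‖e‖ * ((∫ y, ‖fderiv ℝ (lap ψ) y‖) +
        ∑ k, ∫ y, ‖fderiv ℝ (dirDeriv (EuclideanSpace.single k 1)
          (dirDeriv (EuclideanSpace.single j 1) ψ)) y‖) := by
  have hψe : ContDiff ℝ ∞ (dirDeriv e ψ) := contDiff_dirDeriv hψ e
  have hψec : HasCompactSupport (dirDeriv e ψ) := hasCompactSupport_dirDeriv hψc e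
  have b1 : |∫ y, (lap (v j) (x₀ + s • y) -
      dirDeriv (EuclideanSpace.single j 1) q (x₀ + s • y)) * lap (dirDeriv e ψ) y| ≤
      N * (‖e‖ * ∫ y, ‖fderiv ℝ (lap ψ) y‖) := by
    refine (abs_integral_mul_le (contDiff_lap hψe).continuous (hasCompactSupport_lap hψec)
      fun y hy => hvN y (tsupport_dirDeriv_subset _ _ (tsupport_lap_subset _ hy)) j).trans
      (mul_le_mul_of_nonneg_left ?_ hN)
    rw [← dirDeriv_lap hψ]
    exact integral_abs_dirDeriv_le (contDiff_lap hψ) (hasCompactSupport_lap hψc) e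
  have b2 : ∀ k, |∫ y, (lap (v k) (x₀ + s • y) -
      dirDeriv (EuclideanSpace.single k 1) q (x₀ + s • y)) *
      dirDeriv (EuclideanSpace.single k 1)
        (dirDeriv (EuclideanSpace.single j 1) (dirDeriv e ψ)) y| ≤
      N * (‖e‖ * ∫ y, ‖fderiv ℝ (dirDeriv (EuclideanSpace.single k 1)
          (dirDeriv (EuclideanSpace.single j 1) ψ)) y‖) := by
    intro k
    refine (abs_integral_mul_le
      (contDiff_dirDeriv (contDiff_dirDeriv hψe _) _).continuous
      (hasCompactSupport_dirDeriv (hasCompactSupport_dirDeriv hψec _) _)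
      fun y hy => hvN y (tsupport_dirDeriv_subset _ _ (tsupport_dirDeriv_subset _ _
        (tsupport_dirDeriv_subset _ _ hy))) k).trans
      (mul_le_mul_of_nonneg_left ?_ hN)
    rw [dirDeriv_comm hψ, dirDeriv_comm (contDiff_dirDeriv hψ _)]
    exact integral_abs_dirDeriv_le (contDiff_dirDeriv (contDiff_dirDeriv hψ _) _)
      (hasCompactSupport_dirDeriv (hasCompactSupport_dirDeriv hψc _) _) e
  rw [integral_mul_lap_eq (a := fun k y => lap (v k) (x₀ + s • y))
    (b := fun k y => dirDeriv (EuclideanSpace.single k 1) q (x₀ + s • y))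
    (fun k => contDiff_affine (contDiff_lap (hv k)) x₀ s)
    (fun k => contDiff_affine (contDiff_dirDeriv hq _) x₀ s) hψe hψec]
  · refine (abs_sub _ _).trans ((add_le_add b1 ((Finset.abs_sum_le_sum_abs _ _).trans
      (Finset.sum_le_sum fun k _ => b2 k))).trans (le_of_eq ?_))
    rw [← Finset.mul_sum, ← Finset.mul_sum]
    ring
  · intro i k
    rw [dirDeriv_affine (contDiff_dirDeriv hq _), dirDeriv_affine (contDiff_dirDeriv hq _),
      dirDeriv_comm hq]
  · intro y hy
    simp only [dirDeriv_affine (contDiff_lap (hv _)), smul_eq_mul]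
    rw [← Finset.mul_sum, sum_dirDeriv_lap_eq_zero hv
      (hdiv y (tsupport_dirDeriv_subset _ _ hy)), mul_zero]

/-- **Interior gradient estimate** for the linear Stokes system. -/
theorem exists_stokes_gradient_bound (hn : 4 ≤ n) : ∃ K : ℝ, 0 < K ∧
    ∀ (v : Fin n → EuclideanSpace ℝ (Fin n) → ℝ) (q : EuclideanSpace ℝ (Fin n) → ℝ),
    (∀ j, ContDiff ℝ ∞ (v j)) → ContDiff ℝ ∞ q →
    ∀ (x₀ : EuclideanSpace ℝ (Fin n)) (r M N : ℝ), 0 < r → 0 ≤ M → 0 ≤ N →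
    (∀ y ∈ closedBall x₀ r, ∀ j, |v j y| ≤ M) →
    (∀ y ∈ closedBall x₀ r, ∀ j,
      |lap (v j) y - dirDeriv (EuclideanSpace.single j 1) q y| ≤ N) →
    (∀ y ∈ ball x₀ r, ∑ i, dirDeriv (EuclideanSpace.single i 1) (v i) y = 0) →
    ∀ j e, |dirDeriv e (v j) x₀| ≤ K * (M / r + r * N) * ‖e‖ := by
  obtain ⟨φ, ψ, hφ, hψ, hφs, hψs, hφ1, hφψ⟩ := exists_profile hn
  have hφc : HasCompactSupport φ :=
    (isCompact_closedBall _ _).of_isClosed_subset (isClosed_tsupport _) hφs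
  have hψc : HasCompactSupport ψ :=
    (isCompact_closedBall _ _).of_isClosed_subset (isClosed_tsupport _) hψs
  set K₁ := ∫ y, ‖fderiv ℝ φ y‖
  set K₂ := ∫ y, ‖fderiv ℝ (lap ψ) y‖
  set K₃ : Fin n → Fin n → ℝ := fun j k => ∫ y, ‖fderiv ℝ (dirDeriv (EuclideanSpace.single k 1)
      (dirDeriv (EuclideanSpace.single j 1) ψ)) y‖
  have hK₁ : 0 ≤ K₁ := integral_nonneg fun _ => norm_nonneg _
  have hK₂ : 0 ≤ K₂ := integral_nonneg fun _ => norm_nonneg _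
  have hK₃ : ∀ j k, 0 ≤ K₃ j k := fun j k => integral_nonneg fun _ => norm_nonneg _
  have hK₃' : ∀ j, 0 ≤ ∑ k, K₃ j k := fun j => Finset.sum_nonneg fun k _ => hK₃ j k
  have hK₃'' : ∀ j, ∑ k, K₃ j k ≤ ∑ j, ∑ k, K₃ j k := fun j =>
    Finset.single_le_sum (f := fun j => ∑ k, K₃ j k) (fun j _ => hK₃' j) (Finset.mem_univ j)
  have hKs : 0 ≤ ∑ j, ∑ k, K₃ j k := Finset.sum_nonneg fun j _ => hK₃' j
  refine ⟨K₁ + K₂ + ∑ j, ∑ k, K₃ j k + 1, by linarith, ?_⟩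
  intro v q hv hq x₀ r M N hr hM hN hvM hvN hdiv j e
  set g : ℝ → ℝ := fun s => ∫ y, dirDeriv e (v j) (x₀ + s • y) * φ y with hg
  have hmem : ∀ s ∈ Ico 0 r, ∀ y ∈ closedBall (0 : EuclideanSpace ℝ (Fin n)) 1,
      x₀ + s • y ∈ ball x₀ r := by
    intro s hs y hy
    rw [mem_closedBall_zero_iff] at hy
    rw [mem_ball_iff_norm, add_sub_cancel_left, norm_smul, Real.norm_eq_abs, abs_of_nonneg hs.1]
    nlinarith [hs.1, hs.2, norm_nonneg y]
  have hg' : ∀ s, HasDerivAt g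
      (∫ y, lap (v j) (x₀ + s • y) * lap (dirDeriv e ψ) y) s := fun s => by
    rw [← integral_fderiv_dirDeriv_mul (hv j) hψ hψc hφψ]
    exact hasDerivAt_average (contDiff_dirDeriv (hv j) e) hφ.continuous hφs x₀ s
  have hg0 : g 0 = dirDeriv e (v j) x₀ := by
    simp only [hg, zero_smul, add_zero]
    rw [integral_const_mul, hφ1, mul_one]
  have hgr : |g r| ≤ M / r * (‖e‖ * K₁) := by
    have h1 : r * g r = -∫ y, v j (x₀ + r • y) * dirDeriv e φ y := by
      rw [integral_mul_dirDeriv (contDiff_affine (hv j) x₀ r) hφ hφc, dirDeriv_affine (hv j),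
        neg_neg, hg, ← integral_const_mul]
      simp only [smul_eq_mul, mul_assoc]
    have h2 : |∫ y, v j (x₀ + r • y) * dirDeriv e φ y| ≤ M * ∫ y, |dirDeriv e φ y| := by
      refine abs_integral_mul_le (contDiff_dirDeriv hφ e).continuous
        (hasCompactSupport_dirDeriv hφc e) fun y hy => hvM _ ?_ j
      have hy' := hφs (tsupport_dirDeriv_subset _ _ hy)
      rw [mem_closedBall_zero_iff] at hy'
      rw [mem_closedBall_iff_norm, add_sub_cancel_left, norm_smul, Real.norm_eq_abs,
        abs_of_pos hr]
      nlinarith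
    have h3 : r * |g r| ≤ M * (‖e‖ * K₁) := by
      rw [← abs_of_pos hr, ← abs_mul, abs_of_pos hr, h1, abs_neg]
      exact h2.trans (mul_le_mul_of_nonneg_left (integral_abs_dirDeriv_le hφ hφc e) hM)
    rw [div_mul_eq_mul_div, le_div_iff₀ hr]
    linarith
  have hderiv : ∀ s ∈ Ico 0 r, ‖∫ y, lap (v j) (x₀ + s • y) * lap (dirDeriv e ψ) y‖ ≤
      N * ‖e‖ * (K₂ + ∑ k, K₃ j k) := by
    intro s hs
    rw [Real.norm_eq_abs]
    have hs' : ∀ y ∈ tsupport ψ, x₀ + s • y ∈ ball x₀ r := fun y hy => hmem s hs y (hψs hy)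
    exact abs_integral_lap_mul_lap_le hv hq hψ hψc hN
      (fun y hy k => hvN _ (ball_subset_closedBall (hs' y hy)) k)
      (fun y hy => Filter.mem_of_superset (isOpen_ball.mem_nhds (hs' y hy)) hdiv) j e
  have hMV := norm_image_sub_le_of_norm_deriv_le_segment' (fun s _ => (hg' s).hasDerivWithinAt)
    hderiv r (right_mem_Icc.2 hr.le)
  rw [← hg0]
  rw [Real.norm_eq_abs, sub_zero] at hMV
  have hMr : 0 ≤ M / r := div_nonneg hM hr.le
  have hrN : 0 ≤ r * N := mul_nonneg hr.le hN
  have he := norm_nonneg e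
  have htri : |g 0| ≤ |g r| + |g r - g 0| := by
    have := abs_sub_abs_le_abs_sub (g 0) (g r)
    rw [abs_sub_comm] at this
    linarith
  calc |g 0| ≤ M / r * (‖e‖ * K₁) + N * ‖e‖ * (K₂ + ∑ k, K₃ j k) * r := by linarith
    _ = (K₁ * (M / r) + (K₂ + ∑ k, K₃ j k) * (r * N)) * ‖e‖ := by ring
    _ ≤ _ := by
      refine mul_le_mul_of_nonneg_right ?_ he
      rw [mul_add]
      refine add_le_add (mul_le_mul_of_nonneg_right ?_ hMr) (mul_le_mul_of_nonneg_right ?_ hrN)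
      · linarith
      · linarith [hK₃'' j]

end InteriorEstimate

section IteratedDerivatives

variable {E F : Type*} [NormedAddCommGroup E] [NormedSpace ℝ E]
  [NormedAddCommGroup F] [NormedSpace ℝ F] {l : ℕ}

/-- The iterated directional derivative of `f` along the vectors `m`. -/
noncomputable def iterDeriv (m : Fin l → E) (f : E → F) : E → F :=
  fun x => iteratedFDeriv ℝ l f x m

theorem contDiff_iteratedFDeriv {f : E → F} (hf : ContDiff ℝ ∞ f) (l : ℕ) :
    ContDiff ℝ ∞ (iteratedFDeriv ℝ l f) :=
  hf.iteratedFDeriv_right (m := ∞) (i := l) (WithTop.coe_le_coe.2 le_top)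

theorem contDiff_iterDeriv {f : E → F} (hf : ContDiff ℝ ∞ f) (m : Fin l → E) :
    ContDiff ℝ ∞ (iterDeriv m f) :=
  (ContinuousMultilinearMap.apply ℝ (fun _ : Fin l => E) F m).contDiff.comp
    (contDiff_iteratedFDeriv hf l)

theorem iterDeriv_zero (m : Fin 0 → E) (f : E → F) : iterDeriv m f = f := by
  funext x
  simp [iterDeriv]

theorem iterDeriv_succ {f : E → F} (hf : ContDiff ℝ ∞ f) (m : Fin (l + 1) → E) :
    iterDeriv m f = dirDeriv (m 0) (iterDeriv (Fin.tail m) f) := by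
  funext x
  have h := (ContinuousMultilinearMap.apply ℝ (fun _ : Fin l => E) F
    (Fin.tail m)).hasFDerivAt.comp x
    ((contDiff_iteratedFDeriv hf l).differentiable (by simp) x).hasFDerivAt
  unfold iterDeriv dirDeriv
  rw [iteratedFDeriv_succ_apply_left]
  exact (congrArg (fun L : E →L[ℝ] F => L (m 0)) h.fderiv).symm

theorem dirDeriv_iterDeriv {f : E → F} (hf : ContDiff ℝ ∞ f) (e : E) (m : Fin l → E) :
    dirDeriv e (iterDeriv m f) = iterDeriv m (dirDeriv e f) := by
  induction l with
  | zero => simp only [iterDeriv_zero]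
  | succ l ih =>
    rw [iterDeriv_succ hf, iterDeriv_succ (contDiff_dirDeriv hf e),
      dirDeriv_comm (contDiff_iterDeriv hf _), ih]

theorem iterDeriv_sum {ι : Type*} {s : Finset ι} {f : ι → E → F}
    (hf : ∀ i, ContDiff ℝ ∞ (f i)) (m : Fin l → E) :
    iterDeriv m (fun x => ∑ i ∈ s, f i x) = fun x => ∑ i ∈ s, iterDeriv m (f i) x := by
  induction l with
  | zero => simp only [iterDeriv_zero]
  | succ l ih =>
    rw [iterDeriv_succ (ContDiff.sum fun i _ => hf i), ih,
      dirDeriv_sum fun i => contDiff_iterDeriv (hf i) _]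
    simp only [iterDeriv_succ (hf _)]

theorem iterDeriv_sub {f g : E → F} (hf : ContDiff ℝ ∞ f) (hg : ContDiff ℝ ∞ g)
    (m : Fin l → E) :
    iterDeriv m (fun x => f x - g x) = fun x => iterDeriv m f x - iterDeriv m g x := by
  funext x
  unfold iterDeriv
  rw [fun_iteratedFDeriv_sub_apply (hf.contDiffAt.of_le (by exact_mod_cast le_top))
    (hg.contDiffAt.of_le (by exact_mod_cast le_top))]
  rfl

theorem iterDeriv_congr {f g : E → F} {x : E} (h : f =ᶠ[𝓝 x] g) (m : Fin l → E) :
    iterDeriv m f x = iterDeriv m g x := by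
  unfold iterDeriv
  rw [(h.iteratedFDeriv ℝ l).eq_of_nhds]

theorem norm_iterDeriv_le (f : E → F) (m : Fin l → E) (x : E) :
    ‖iterDeriv m f x‖ ≤ ‖iteratedFDeriv ℝ l f x‖ * ∏ i, ‖m i‖ :=
  ContinuousMultilinearMap.le_opNorm _ _

theorem contDiff_component {n : ℕ} {u : E → EuclideanSpace ℝ (Fin n)} (hu : ContDiff ℝ ∞ u)
    (j : Fin n) : ContDiff ℝ ∞ (fun y => u y j) :=
  (EuclideanSpace.proj j : EuclideanSpace ℝ (Fin n) →L[ℝ] ℝ).contDiff.comp hu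

theorem iterDeriv_component {n : ℕ} {u : E → EuclideanSpace ℝ (Fin n)} (hu : ContDiff ℝ ∞ u)
    (m : Fin l → E) (j : Fin n) :
    iterDeriv m (fun y => u y j) = fun y => iterDeriv m u y j := by
  funext x
  have := (EuclideanSpace.proj j : EuclideanSpace ℝ (Fin n) →L[ℝ] ℝ).iteratedFDeriv_comp_left
    (hu.contDiffAt (x := x)) (i := l) (by exact_mod_cast le_top)
  exact congrArg (fun L => L m) this

theorem dirDeriv_component {n : ℕ} {u : E → EuclideanSpace ℝ (Fin n)} (hu : ContDiff ℝ ∞ u)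
    (e : E) (j : Fin n) :
    dirDeriv e (fun y => u y j) = fun y => dirDeriv e u y j := by
  funext x
  have h := (EuclideanSpace.proj j : EuclideanSpace ℝ (Fin n) →L[ℝ] ℝ).hasFDerivAt.comp x
    (hu.differentiable (by simp) x).hasFDerivAt
  exact congrArg (fun L : E →L[ℝ] ℝ => L e) h.fderiv

theorem norm_le_sum_abs {n : ℕ} (w : EuclideanSpace ℝ (Fin n)) :
    ‖w‖ ≤ ∑ j, |w j| := by
  conv_lhs => rw [← (EuclideanSpace.basisFun (Fin n) ℝ).sum_repr w]
  refine (norm_sum_le _ _).trans (le_of_eq ?_)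
  simp [norm_smul]

end IteratedDerivatives

section NavierStokes

variable {n l : ℕ} {u : EuclideanSpace ℝ (Fin n) → EuclideanSpace ℝ (Fin n)}
  {p : EuclideanSpace ℝ (Fin n) → ℝ} {U : Set (EuclideanSpace ℝ (Fin n))}

/-- The steady Navier-Stokes equations on `U`, for functions defined on the whole space. -/
structure SolvesNS (u : EuclideanSpace ℝ (Fin n) → EuclideanSpace ℝ (Fin n))
    (p : EuclideanSpace ℝ (Fin n) → ℝ) (U : Set (EuclideanSpace ℝ (Fin n))) : Prop where
  momentum : ∀ x ∈ U, ∀ j, lap (fun z => u z j) x - dirDeriv (EuclideanSpace.single j 1) p x =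
    ∑ i, u x i * dirDeriv (EuclideanSpace.single i 1) (fun z => u z j) x
  divergence : ∀ x ∈ U, ∑ i, dirDeriv (EuclideanSpace.single i 1) (fun z => u z i) x = 0

/-- The convection term `(u · ∇) u`. -/
noncomputable def convection (u : EuclideanSpace ℝ (Fin n) → EuclideanSpace ℝ (Fin n)) :
    EuclideanSpace ℝ (Fin n) → EuclideanSpace ℝ (Fin n) :=
  fun x => fderiv ℝ u x (u x)

theorem contDiff_convection (hu : ContDiff ℝ ∞ u) : ContDiff ℝ ∞ (convection u) :=
  (hu.fderiv_right (m := ∞) (by simp)).clm_apply hu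

theorem convection_apply (hu : ContDiff ℝ ∞ u) (x : EuclideanSpace ℝ (Fin n)) (j : Fin n) :
    convection u x j =
      ∑ i, u x i * dirDeriv (EuclideanSpace.single i 1) (fun z => u z j) x := by
  rw [← fderiv_apply_eq_sum]
  exact (congrFun (dirDeriv_component hu (u x) j) x).symm

theorem norm_iteratedFDeriv_convection_le (hu : ContDiff ℝ ∞ u) (x : EuclideanSpace ℝ (Fin n)) :
    ‖iteratedFDeriv ℝ l (convection u) x‖ ≤ ∑ i ∈ Finset.range (l + 1), (l.choose i : ℝ) *
      ‖iteratedFDeriv ℝ (i + 1) u x‖ * ‖iteratedFDeriv ℝ (l - i) u x‖ := by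
  have h := norm_iteratedFDeriv_clm_apply (𝕜 := ℝ) (N := ∞)
    (hu.fderiv_right (m := ∞) (by simp)) hu x (n := l) (by exact_mod_cast le_top)
  simp only [norm_iteratedFDeriv_fderiv] at h
  exact h

theorem lap_iterDeriv {f : EuclideanSpace ℝ (Fin n) → ℝ} (hf : ContDiff ℝ ∞ f)
    (m : Fin l → EuclideanSpace ℝ (Fin n)) : lap (iterDeriv m f) = iterDeriv m (lap f) := by
  unfold lap
  rw [iterDeriv_sum fun i => contDiff_dirDeriv (contDiff_dirDeriv hf _) _]
  simp only [dirDeriv_iterDeriv hf, dirDeriv_iterDeriv (contDiff_dirDeriv hf _)]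

/-- The differentiated momentum equation. -/
theorem SolvesNS.iterDeriv_momentum (h : SolvesNS u p U) (hU : IsOpen U) (hu : ContDiff ℝ ∞ u)
    (hp : ContDiff ℝ ∞ p) (m : Fin l → EuclideanSpace ℝ (Fin n)) {x : EuclideanSpace ℝ (Fin n)}
    (hx : x ∈ U) (j : Fin n) :
    lap (fun z => iterDeriv m u z j) x - dirDeriv (EuclideanSpace.single j 1) (iterDeriv m p) x =
      iterDeriv m (convection u) x j := by
  have huj := contDiff_component hu j
  rw [← iterDeriv_component hu m j, lap_iterDeriv huj, dirDeriv_iterDeriv hp]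
  have h1 := congrFun (iterDeriv_sub (contDiff_lap huj)
    (contDiff_dirDeriv hp (EuclideanSpace.single j 1)) m) x
  have h2 := congrFun (iterDeriv_component (contDiff_convection hu) m j) x
  simp only at h1 h2
  rw [← h1, ← h2]
  refine iterDeriv_congr ?_ m
  filter_upwards [hU.mem_nhds hx] with y hy
  rw [h.momentum y hy, convection_apply hu]

theorem SolvesNS.iterDeriv_divergence (h : SolvesNS u p U) (hU : IsOpen U) (hu : ContDiff ℝ ∞ u)
    (m : Fin l → EuclideanSpace ℝ (Fin n)) {x : EuclideanSpace ℝ (Fin n)} (hx : x ∈ U) :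
    ∑ i, dirDeriv (EuclideanSpace.single i 1) (fun z => iterDeriv m u z i) x = 0 := by
  have huj := contDiff_component hu
  simp only [← iterDeriv_component hu m, dirDeriv_iterDeriv (huj _)]
  have h1 := congrFun (iterDeriv_sum (s := Finset.univ)
    (fun i => contDiff_dirDeriv (huj i) (EuclideanSpace.single i 1)) m) x
  simp only at h1
  rw [← h1]
  have h2 : (fun x => ∑ i, dirDeriv (EuclideanSpace.single i 1) (fun z => u z i) x) =ᶠ[𝓝 x]
      fun _ => 0 := by
    filter_upwards [hU.mem_nhds hx] with y hy using h.divergence y hy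
  rw [iterDeriv_congr h2]
  simp [iterDeriv]

theorem abs_component_le (w : EuclideanSpace ℝ (Fin n)) (j : Fin n) : |w j| ≤ ‖w‖ := by
  simpa using PiLp.norm_apply_le w j

/-- Interior gradient estimate for the `l`-th derivative of a solution. -/
theorem exists_norm_iteratedFDeriv_succ_le (hn : 4 ≤ n) : ∃ K : ℝ, 0 < K ∧
    ∀ (l : ℕ) (u : EuclideanSpace ℝ (Fin n) → EuclideanSpace ℝ (Fin n))
    (p : EuclideanSpace ℝ (Fin n) → ℝ) (U : Set (EuclideanSpace ℝ (Fin n))),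
    ContDiff ℝ ∞ u → ContDiff ℝ ∞ p → IsOpen U → SolvesNS u p U →
    ∀ (x : EuclideanSpace ℝ (Fin n)) (r M N : ℝ), 0 < r → 0 ≤ M → 0 ≤ N → closedBall x r ⊆ U →
    (∀ y ∈ closedBall x r, ‖iteratedFDeriv ℝ l u y‖ ≤ M) →
    (∀ y ∈ closedBall x r, ‖iteratedFDeriv ℝ l (convection u) y‖ ≤ N) →
    ‖iteratedFDeriv ℝ (l + 1) u x‖ ≤ K * (M / r + r * N) := by
  obtain ⟨K, hK, hgrad⟩ := exists_stokes_gradient_bound hn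
  have hn0 : (0 : ℝ) < n := by exact_mod_cast (by omega : 0 < n)
  refine ⟨n * K, by positivity, ?_⟩
  intro l u p U hu hp hU hNS x r M N hr hM hN hball huM hcN
  refine ContinuousMultilinearMap.opNorm_le_bound (by positivity) fun m => ?_
  set P := ∏ i, ‖Fin.tail m i‖
  have hP : 0 ≤ P := Finset.prod_nonneg fun i _ => norm_nonneg _
  have hcomp : ∀ j, |iterDeriv m u x j| ≤ K * (M * P / r + r * (N * P)) * ‖m 0‖ := by
    intro j
    have huI := contDiff_iterDeriv hu (Fin.tail m)
    have h1 := congrFun (dirDeriv_component huI (m 0) j) x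
    rw [iterDeriv_succ hu]
    simp only at h1
    rw [← h1]
    refine hgrad (fun j z => iterDeriv (Fin.tail m) u z j) (iterDeriv (Fin.tail m) p)
      (contDiff_component huI) (contDiff_iterDeriv hp _) x r (M * P) (N * P) hr
      (by positivity) (by positivity) ?_ ?_ ?_ j (m 0)
    · intro y hy j
      exact (abs_component_le _ j).trans ((norm_iterDeriv_le u _ y).trans
        (mul_le_mul_of_nonneg_right (huM y hy) hP))
    · intro y hy j
      rw [hNS.iterDeriv_momentum hU hu hp _ (hball hy)]
      exact (abs_component_le _ j).trans ((norm_iterDeriv_le _ _ y).trans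
        (mul_le_mul_of_nonneg_right (hcN y hy) hP))
    · intro y hy
      exact hNS.iterDeriv_divergence hU hu _ (hball (ball_subset_closedBall hy))
  calc ‖iteratedFDeriv ℝ (l + 1) u x m‖ ≤ ∑ j, |iterDeriv m u x j| :=
        norm_le_sum_abs _
    _ ≤ ∑ _j : Fin n, K * (M * P / r + r * (N * P)) * ‖m 0‖ :=
        Finset.sum_le_sum fun j _ => hcomp j
    _ = n * K * (M / r + r * N) * ∏ i, ‖m i‖ := by
      rw [Finset.sum_const, Finset.card_univ, Fintype.card_fin, nsmul_eq_mul, Fin.prod_univ_succ]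
      change _ = n * K * (M / r + r * N) * (‖m 0‖ * P)
      ring

/-- Absorption: a linear bound of `G` at a point in terms of the supremum of `G` on small balls
becomes an unconditional bound, by looking at a maximum of `dist(·, ∂B) G`. -/
theorem le_of_absorption {E : Type*} [NormedAddCommGroup E] [ProperSpace E] {G : E → ℝ}
    (hG : Continuous G) (hG0 : ∀ x, 0 ≤ G x) {x₀ : E}
    {R a b c : ℝ} (hR : 0 < R) (ha : 0 ≤ a) (hb : 0 ≤ b) (hc : 0 ≤ c)
    (h : ∀ x r S, 0 < r → 0 ≤ S → closedBall x r ⊆ ball x₀ R → (∀ y ∈ closedBall x r, G y ≤ S) →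
      G x ≤ a / r + r * (b + c / R * S)) :
    G x₀ ≤ (2 * a * (2 + 4 * c) + R ^ 2 * b) / R := by
  obtain ⟨x, hx, hmax⟩ := (isCompact_closedBall x₀ R).exists_isMaxOn
    ⟨x₀, mem_closedBall_self hR.le⟩
    (f := fun y => (R - dist y x₀) * G y) (by fun_prop)
  have hx0 : R * G x₀ ≤ (R - dist x x₀) * G x := by
    simpa using hmax (mem_closedBall_self hR.le)
  rw [le_div_iff₀ hR, mul_comm]
  refine hx0.trans ?_
  set d := R - dist x x₀ with hd
  set S := G x with hS
  have hS0 : 0 ≤ S := hG0 x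
  rcases (sub_nonneg.2 (mem_closedBall.1 hx)).eq_or_lt with hd0 | hdpos
  · rw [← hd] at hd0
    rw [← hd0, zero_mul]
    positivity
  rw [← hd] at hdpos
  have hdR : d ≤ R := by linarith [dist_nonneg (x := x) (y := x₀)]
  set ε := 1 / (2 + 4 * c) with hε
  have hε0 : 0 < ε := by positivity
  have hε1 : ε * (2 + 4 * c) = 1 := by rw [hε]; field_simp
  have hεc : 0 ≤ ε * c := by positivity
  have hr : 0 < ε * d := by positivity
  have hrd : ε * d ≤ d / 2 := by nlinarith
  have hdist : ∀ y ∈ closedBall x (ε * d), d / 2 ≤ R - dist y x₀ := fun y hy => by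
    have := dist_triangle y x x₀
    have := mem_closedBall.1 hy
    linarith
  have key := h x (ε * d) (2 * S) hr (by positivity)
    (fun y hy => by
      have := hdist y hy
      rw [mem_ball]
      linarith)
    (fun y hy => by
      have h1 := hdist y hy
      have h2 : (R - dist y x₀) * G y ≤ d * S :=
        hmax (mem_closedBall.2 (by linarith))
      have h3 : d / 2 * G y ≤ d * S := (mul_le_mul_of_nonneg_right h1 (hG0 y)).trans h2
      have h4 : d * G y ≤ d * (2 * S) := by linarith
      exact le_of_mul_le_mul_left h4 hdpos)
  rw [← hS] at key
  have e1 : ε * d * (c / R * (2 * S)) ≤ S / 2 := by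
    have hdR' : d / R ≤ 1 := (div_le_one hR).2 hdR
    have : ε * d * (c / R * (2 * S)) = (2 * (ε * c)) * (d / R) * S := by ring
    rw [this]
    have h1 : 2 * (ε * c) * (d / R) ≤ 1 / 2 * 1 :=
      mul_le_mul (by nlinarith) hdR' (by positivity) (by norm_num)
    nlinarith
  have e2 : S ≤ 2 * (a / (ε * d)) + 2 * (ε * d) * b := by
    rw [mul_add] at key
    linarith
  have e3 : d * (a / (ε * d)) = a * (2 + 4 * c) := by
    rw [hε]
    field_simp
  have e4 : d * (2 * (ε * d) * b) ≤ R ^ 2 * b := by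
    have h1 : 2 * ε ≤ 1 := by nlinarith
    have h2 : d * d ≤ R ^ 2 := by nlinarith
    have h3 : d * (2 * (ε * d) * b) = 2 * ε * (d * d * b) := by ring
    rw [h3]
    have h4 : d * d * b ≤ R ^ 2 * b := mul_le_mul_of_nonneg_right h2 hb
    have h5 : 0 ≤ d * d * b := by positivity
    nlinarith
  calc d * S ≤ d * (2 * (a / (ε * d)) + 2 * (ε * d) * b) :=
        mul_le_mul_of_nonneg_left e2 hdpos.le
    _ = 2 * (d * (a / (ε * d))) + d * (2 * (ε * d) * b) := by ring
    _ ≤ _ := by rw [e3]; linarith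

end NavierStokes

section Extension

variable {n : ℕ} {u v : EuclideanSpace ℝ (Fin n) → EuclideanSpace ℝ (Fin n)}
  {p q : EuclideanSpace ℝ (Fin n) → ℝ} {U V : Set (EuclideanSpace ℝ (Fin n))}

theorem eventuallyEq_dirDeriv {f g : EuclideanSpace ℝ (Fin n) → ℝ}
    {x : EuclideanSpace ℝ (Fin n)} (h : f =ᶠ[𝓝 x] g) (e : EuclideanSpace ℝ (Fin n)) :
    dirDeriv e f =ᶠ[𝓝 x] dirDeriv e g := by
  filter_upwards [h.fderiv (𝕜 := ℝ)] with y hy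
  unfold dirDeriv
  rw [hy]

theorem lap_congr {f g : EuclideanSpace ℝ (Fin n) → ℝ}
    {x : EuclideanSpace ℝ (Fin n)} (h : f =ᶠ[𝓝 x] g) : lap f x = lap g x :=
  Finset.sum_congr rfl fun _ _ =>
    (eventuallyEq_dirDeriv (eventuallyEq_dirDeriv h _) _).eq_of_nhds

theorem SolvesNS.congr (h : SolvesNS u p U) (hVU : V ⊆ U) (huv : ∀ x ∈ V, v =ᶠ[𝓝 x] u)
    (hpq : ∀ x ∈ V, q =ᶠ[𝓝 x] p) : SolvesNS v q V := by
  have hj : ∀ x ∈ V, ∀ j, (fun z => v z j) =ᶠ[𝓝 x] fun z => u z j := fun x hx j => by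
    filter_upwards [huv x hx] with y hy
    rw [hy]
  constructor
  · intro x hx j
    rw [lap_congr (hj x hx j), (eventuallyEq_dirDeriv (hpq x hx) _).eq_of_nhds,
      h.momentum x (hVU hx) j]
    refine Finset.sum_congr rfl fun i _ => ?_
    rw [(eventuallyEq_dirDeriv (hj x hx j) _).eq_of_nhds, (huv x hx).eq_of_nhds]
  · intro x hx
    rw [← h.divergence x (hVU hx)]
    exact Finset.sum_congr rfl fun i _ => (eventuallyEq_dirDeriv (hj x hx i) _).eq_of_nhds

/-- A function which is smooth away from the origin agrees, away from a small ball, with a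
function which is smooth everywhere. -/
theorem exists_smooth_extension {F : Type*} [NormedAddCommGroup F] [NormedSpace ℝ F]
    {f : EuclideanSpace ℝ (Fin n) → F} (hf : ContDiffOn ℝ ∞ f {x | x ≠ 0}) {δ : ℝ} (hδ : 0 < δ) :
    ∃ g : EuclideanSpace ℝ (Fin n) → F, ContDiff ℝ ∞ g ∧ ∀ y, δ ≤ ‖y‖ → g y = f y := by
  let φ : ContDiffBump (0 : EuclideanSpace ℝ (Fin n)) := ⟨δ / 2, δ, by positivity, by linarith⟩
  refine ⟨fun y => (1 - φ y) • f y, contDiff_iff_contDiffAt.2 fun y => ?_, fun y hy => ?_⟩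
  · by_cases hy : y = 0
    · have : (fun y => (1 - φ y) • f y) =ᶠ[𝓝 y] fun _ => (0 : F) := by
        rw [hy]
        filter_upwards [φ.eventuallyEq_one] with z hz
        simp [hz]
      exact contDiffAt_const.congr_of_eventuallyEq this
    · exact (contDiffAt_const.sub φ.contDiffAt).smul
        (hf.contDiffAt (isOpen_ne.mem_nhds hy))
  · have : φ y = 0 := φ.zero_of_le_dist (by simpa using hy)
    simp [this]

theorem half_norm_lt_norm {E : Type*} [NormedAddCommGroup E] {x y : E}
    (hy : y ∈ ball x (‖x‖ / 2)) : ‖x‖ / 2 < ‖y‖ := by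
  have h1 := mem_ball_iff_norm'.1 hy
  have h2 := norm_sub_norm_le x y
  linarith

/-- Near a point away from the origin, a solution on the punctured space agrees with globally
defined smooth functions. -/
theorem SolvesNS.exists_extension (h : SolvesNS u p {x | x ≠ 0})
    (hu : ContDiffOn ℝ ∞ u {x | x ≠ 0}) (hp : ContDiffOn ℝ ∞ p {x | x ≠ 0})
    {x : EuclideanSpace ℝ (Fin n)} (hx : x ≠ 0) :
    ∃ v q, ContDiff ℝ ∞ v ∧ ContDiff ℝ ∞ q ∧ SolvesNS v q (ball x (‖x‖ / 2)) ∧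
      (∀ y ∈ ball x (‖x‖ / 2), v =ᶠ[𝓝 y] u) ∧ ∀ y ∈ ball x (‖x‖ / 2), q =ᶠ[𝓝 y] p := by
  have hx0 := norm_pos_iff.2 hx
  obtain ⟨v, hv, hvu⟩ := exists_smooth_extension hu (half_pos hx0)
  obtain ⟨q, hq, hqp⟩ := exists_smooth_extension hp (half_pos hx0)
  have hvu' : ∀ y ∈ ball x (‖x‖ / 2), v =ᶠ[𝓝 y] u := fun y hy => by
    filter_upwards [isOpen_ball.mem_nhds hy] with z hz using hvu z (half_norm_lt_norm hz).le
  have hqp' : ∀ y ∈ ball x (‖x‖ / 2), q =ᶠ[𝓝 y] p := fun y hy => by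
    filter_upwards [isOpen_ball.mem_nhds hy] with z hz using hqp z (half_norm_lt_norm hz).le
  refine ⟨v, q, hv, hq, h.congr (fun y hy => ?_) hvu' hqp', hvu', hqp'⟩
  exact norm_pos_iff.1 ((half_pos hx0).trans (half_norm_lt_norm hy))

end Extension

section Decay

variable {n l : ℕ} {u : EuclideanSpace ℝ (Fin n) → EuclideanSpace ℝ (Fin n)}
  {p : EuclideanSpace ℝ (Fin n) → ℝ} {U : Set (EuclideanSpace ℝ (Fin n))}

/-- Scale invariant interior estimate for the derivative of order `l + 1` in terms of the
derivatives of lower order. -/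
theorem exists_interior_bound (hn : 4 ≤ n) {A : ℕ → ℝ} (hA : ∀ i, 0 ≤ A i) (l : ℕ) :
    ∃ B : ℝ, 0 < B ∧ ∀ (u : EuclideanSpace ℝ (Fin n) → EuclideanSpace ℝ (Fin n))
    (p : EuclideanSpace ℝ (Fin n) → ℝ) (x₀ : EuclideanSpace ℝ (Fin n)) (R : ℝ), 0 < R →
    ContDiff ℝ ∞ u → ContDiff ℝ ∞ p → SolvesNS u p (ball x₀ R) →
    (∀ i ≤ l, ∀ y ∈ ball x₀ R, ‖iteratedFDeriv ℝ i u y‖ ≤ A i / R ^ (1 + i)) →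
    ‖iteratedFDeriv ℝ (l + 1) u x₀‖ ≤ B / R ^ (1 + (l + 1)) := by
  obtain ⟨K, hK, hgrad⟩ := exists_norm_iteratedFDeriv_succ_le hn
  set B₀ := ∑ i ∈ Finset.range l, (l.choose i : ℝ) * A (i + 1) * A (l - i) with hB₀
  have hB₀0 : 0 ≤ B₀ := Finset.sum_nonneg fun i _ =>
    mul_nonneg (mul_nonneg (Nat.cast_nonneg _) (hA _)) (hA _)
  have hA0 := hA 0
  have hAl := hA l
  refine ⟨2 * (K * A l) * (2 + 4 * (K * A 0)) + K * B₀ + 1, by positivity, ?_⟩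
  intro u p x₀ R hR hu hp hNS hder
  have key := le_of_absorption (G := fun y => ‖iteratedFDeriv ℝ (l + 1) u y‖) (x₀ := x₀) (R := R)
    (a := K * (A l / R ^ (1 + l))) (b := K * (B₀ / R ^ (l + 3))) (c := K * A 0)
    (contDiff_iteratedFDeriv hu (l + 1)).continuous.norm (fun _ => norm_nonneg _) hR
    (by positivity) (by positivity) (by positivity) ?_
  · refine key.trans ?_
    rw [div_le_div_iff₀ hR (by positivity)]
    have e1 : R ^ (1 + (l + 1)) * (R ^ (1 + l))⁻¹ = R := by
      rw [show 1 + (l + 1) = (1 + l) + 1 by ring, pow_succ]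
      field_simp
    have e2 : R ^ (1 + (l + 1)) * (R ^ 2 * (R ^ (l + 3))⁻¹) = R := by
      rw [show l + 3 = (1 + l) + 2 by ring, show 1 + (l + 1) = (1 + l) + 1 by ring, pow_succ,
        pow_add R (1 + l) 2]
      field_simp
    calc (2 * (K * (A l / R ^ (1 + l))) * (2 + 4 * (K * A 0)) + R ^ 2 * (K * (B₀ / R ^ (l + 3)))) *
          R ^ (1 + (l + 1)) = 2 * (K * A l) * (2 + 4 * (K * A 0)) *
            (R ^ (1 + (l + 1)) * (R ^ (1 + l))⁻¹) +
            K * B₀ * (R ^ (1 + (l + 1)) * (R ^ 2 * (R ^ (l + 3))⁻¹)) := by ring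
      _ ≤ _ := by rw [e1, e2]; linarith
  · intro x r S hr hS hball hGS
    refine (hgrad l u p (ball x₀ R) hu hp isOpen_ball hNS x r (A l / R ^ (1 + l))
      (B₀ / R ^ (l + 3) + A 0 / R * S) hr (by positivity) (by positivity) hball
      (fun y hy => hder l le_rfl y (hball hy)) fun y hy => ?_).trans (le_of_eq (by ring))
    refine (norm_iteratedFDeriv_convection_le hu y).trans ?_
    rw [Finset.sum_range_succ, hB₀, Finset.sum_div]
    refine add_le_add (Finset.sum_le_sum fun i hi => ?_) ?_
    · have hil := Finset.mem_range.1 hi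
      have h1 := hder (i + 1) (by omega) y (hball hy)
      have h2 := hder (l - i) (by omega) y (hball hy)
      have := hA (i + 1)
      calc (l.choose i : ℝ) * ‖iteratedFDeriv ℝ (i + 1) u y‖ * ‖iteratedFDeriv ℝ (l - i) u y‖
          ≤ (l.choose i : ℝ) * (A (i + 1) / R ^ (1 + (i + 1))) *
            (A (l - i) / R ^ (1 + (l - i))) := by gcongr
        _ = _ := by
          rw [show l + 3 = (1 + (i + 1)) + (1 + (l - i)) by omega, pow_add _ (1 + (i + 1))]
          field_simp
    · have h0 := hder 0 (Nat.zero_le _) y (hball hy)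
      rw [Nat.choose_self, Nat.cast_one, one_mul, Nat.sub_self, mul_comm]
      have : A 0 / R ^ (1 + 0) = A 0 / R := by simp
      exact mul_le_mul (h0.trans this.le) (hGS y hy) (norm_nonneg _) (by positivity)

theorem exists_norm_iteratedFDeriv_velocity_le (hn : 4 ≤ n) (h : SolvesNS u p {x | x ≠ 0})
    (hu : ContDiffOn ℝ ∞ u {x | x ≠ 0}) (hp : ContDiffOn ℝ ∞ p {x | x ≠ 0}) {C : ℝ} (hC : 0 < C)
    (hbound : ∀ x ≠ 0, ‖u x‖ ≤ C / ‖x‖) (l : ℕ) :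
    ∃ A : ℝ, 0 < A ∧ ∀ x ≠ 0, ‖iteratedFDeriv ℝ l u x‖ ≤ A / ‖x‖ ^ (1 + l) := by
  induction l using Nat.strong_induction_on with
  | _ l ih =>
  rcases l with _ | l
  · exact ⟨C, hC, fun x hx => by simpa using hbound x hx⟩
  have ih' : ∀ i, ∃ A : ℝ, 0 < A ∧ (i ≤ l → ∀ x ≠ 0,
      ‖iteratedFDeriv ℝ i u x‖ ≤ A / ‖x‖ ^ (1 + i)) := fun i => by
    by_cases hi : i ≤ l
    · obtain ⟨A, hA, hAx⟩ := ih i (by omega)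
      exact ⟨A, hA, fun _ => hAx⟩
    · exact ⟨1, one_pos, fun h => absurd h hi⟩
  choose A hA hAx using ih'
  obtain ⟨B, hB, hBx⟩ := exists_interior_bound hn (fun i => (hA i).le) l
  refine ⟨B * 2 ^ (1 + (l + 1)), by positivity, fun x hx => ?_⟩
  obtain ⟨v, q, hv, hq, hvq, hvu, -⟩ := h.exists_extension hu hp hx
  have hx0 := norm_pos_iff.2 hx
  have hxm : x ∈ ball x (‖x‖ / 2) := mem_ball_self (half_pos hx0)
  rw [← ((hvu x hxm).iteratedFDeriv ℝ (l + 1)).eq_of_nhds]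
  refine (hBx v q x (‖x‖ / 2) (half_pos hx0) hv hq hvq fun i hi y hy => ?_).trans (le_of_eq ?_)
  · rw [((hvu y hy).iteratedFDeriv ℝ i).eq_of_nhds]
    have hy0 := half_norm_lt_norm hy
    have := hA i
    refine (hAx i hi y (norm_pos_iff.1 ((half_pos hx0).trans hy0))).trans ?_
    gcongr
  · rw [div_pow]
    field_simp

/-- The momentum equation controls the derivatives of the pressure by those of the velocity. -/
theorem SolvesNS.norm_iteratedFDeriv_pressure_le (h : SolvesNS u p U) (hU : IsOpen U)
    (hu : ContDiff ℝ ∞ u) (hp : ContDiff ℝ ∞ p) {x : EuclideanSpace ℝ (Fin n)} (hx : x ∈ U) :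
    ‖iteratedFDeriv ℝ (l + 1) p x‖ ≤
      n * (n * ‖iteratedFDeriv ℝ (l + 2) u x‖ + ‖iteratedFDeriv ℝ l (convection u) x‖) := by
  refine ContinuousMultilinearMap.opNorm_le_bound (by positivity) fun m => ?_
  set t := Fin.tail m with ht
  set P := ∏ i, ‖t i‖ with hP
  set a := ‖iteratedFDeriv ℝ (l + 2) u x‖
  set b := ‖iteratedFDeriv ℝ l (convection u) x‖
  have hP0 : 0 ≤ P := Finset.prod_nonneg fun i _ => norm_nonneg _
  have hlap : ∀ j, |lap (fun z => iterDeriv t u z j) x| ≤ n * (a * P) := by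
    intro j
    refine (Finset.abs_sum_le_sum_abs _ _).trans ?_
    have : ∀ i : Fin n, |dirDeriv (EuclideanSpace.single i 1)
        (dirDeriv (EuclideanSpace.single i 1) fun z => iterDeriv t u z j) x| ≤ a * P := by
      intro i
      set e : EuclideanSpace ℝ (Fin n) := EuclideanSpace.single i 1 with he
      have he1 : ‖e‖ = 1 := by simp [he]
      have h1 : dirDeriv e (iterDeriv t u) = iterDeriv (Fin.cons e t : Fin (l + 1) → _) u :=
        (iterDeriv_succ hu (Fin.cons e t : Fin (l + 1) → _)).symm
      have h2 : dirDeriv e (iterDeriv (Fin.cons e t : Fin (l + 1) → _) u) =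
          iterDeriv (Fin.cons e (Fin.cons e t : Fin (l + 1) → _) : Fin (l + 2) → _) u :=
        (iterDeriv_succ hu (Fin.cons e (Fin.cons e t : Fin (l + 1) → _) : Fin (l + 2) → _)).symm
      rw [dirDeriv_component (contDiff_iterDeriv hu t), h1,
        dirDeriv_component (contDiff_iterDeriv hu _), h2]
      refine (abs_component_le _ j).trans ((norm_iterDeriv_le _ _ x).trans (le_of_eq ?_))
      simp [Fin.prod_univ_succ, he1, hP, a]
    exact (Finset.sum_le_sum fun i _ => this i).trans (by simp)
  have hgrad : ∀ j, |dirDeriv (EuclideanSpace.single j 1) (iterDeriv t p) x| ≤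
      n * (a * P) + b * P := by
    intro j
    have h1 := h.iterDeriv_momentum hU hu hp t hx j
    have h2 := (abs_component_le (iterDeriv t (convection u) x) j).trans
      (norm_iterDeriv_le _ _ x)
    have h3 : dirDeriv (EuclideanSpace.single j 1) (iterDeriv t p) x =
      lap (fun z => iterDeriv t u z j) x - iterDeriv t (convection u) x j := by linarith
    rw [h3]
    exact (abs_sub _ _).trans (add_le_add (hlap j) h2)
  have h4 : iteratedFDeriv ℝ (l + 1) p x m =
      ∑ j, m 0 j * dirDeriv (EuclideanSpace.single j 1) (iterDeriv t p) x := by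
    rw [← fderiv_apply_eq_sum]
    exact congrFun (iterDeriv_succ hp m) x
  rw [h4, Real.norm_eq_abs]
  calc _ ≤ ∑ j : Fin n, ‖m 0‖ * (n * (a * P) + b * P) := by
        refine (Finset.abs_sum_le_sum_abs _ _).trans (Finset.sum_le_sum fun j _ => ?_)
        rw [abs_mul]
        exact mul_le_mul (abs_component_le _ j) (hgrad j) (abs_nonneg _) (norm_nonneg _)
    _ = n * (n * a + b) * ∏ i, ‖m i‖ := by
      rw [Finset.sum_const, Finset.card_univ, Fintype.card_fin, nsmul_eq_mul, Fin.prod_univ_succ]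
      change _ = n * (n * a + b) * (‖m 0‖ * P)
      ring

theorem exists_norm_iteratedFDeriv_pressure_le (hn : 4 ≤ n) (h : SolvesNS u p {x | x ≠ 0})
    (hu : ContDiffOn ℝ ∞ u {x | x ≠ 0}) (hp : ContDiffOn ℝ ∞ p {x | x ≠ 0}) {C : ℝ} (hC : 0 < C)
    (hbound : ∀ x ≠ 0, ‖u x‖ ≤ C / ‖x‖) (l : ℕ) :
    ∃ A : ℝ, 0 < A ∧ ∀ x ≠ 0, ‖iteratedFDeriv ℝ (l + 1) p x‖ ≤ A / ‖x‖ ^ (2 + (l + 1)) := by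
  choose A hA hAx using exists_norm_iteratedFDeriv_velocity_le hn h hu hp hC hbound
  have hn0 : (0 : ℝ) < n := by exact_mod_cast (by omega : 0 < n)
  have hB : 0 ≤ ∑ i ∈ Finset.range (l + 1), (l.choose i : ℝ) * A (i + 1) * A (l - i) :=
    Finset.sum_nonneg fun i _ => mul_nonneg (mul_nonneg (Nat.cast_nonneg _) (hA _).le) (hA _).le
  have hA2 := hA (l + 2)
  refine ⟨n * (n * A (l + 2) +
    ∑ i ∈ Finset.range (l + 1), (l.choose i : ℝ) * A (i + 1) * A (l - i)), by positivity,
    fun x hx => ?_⟩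
  obtain ⟨v, q, hv, hq, hvq, hvu, hqp⟩ := h.exists_extension hu hp hx
  have hx0 := norm_pos_iff.2 hx
  have hxm : x ∈ ball x (‖x‖ / 2) := mem_ball_self (half_pos hx0)
  rw [← ((hqp x hxm).iteratedFDeriv ℝ (l + 1)).eq_of_nhds]
  refine (hvq.norm_iteratedFDeriv_pressure_le isOpen_ball hv hq hxm).trans ?_
  have hder : ∀ i, ‖iteratedFDeriv ℝ i v x‖ ≤ A i / ‖x‖ ^ (1 + i) := fun i => by
    rw [((hvu x hxm).iteratedFDeriv ℝ i).eq_of_nhds]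
    exact hAx i x hx
  rw [mul_div_assoc, add_div, Finset.sum_div, mul_div_assoc]
  refine mul_le_mul_of_nonneg_left (add_le_add (mul_le_mul_of_nonneg_left ?_ hn0.le)
    ((norm_iteratedFDeriv_convection_le hv x).trans (Finset.sum_le_sum fun i hi => ?_))) hn0.le
  · refine (hder (l + 2)).trans (le_of_eq ?_)
    rw [show 2 + (l + 1) = 1 + (l + 2) by ring]
  · have hil := Finset.mem_range.1 hi
    have h1 := hder (i + 1)
    have h2 := hder (l - i)
    have := hA (i + 1)
    calc (l.choose i : ℝ) * ‖iteratedFDeriv ℝ (i + 1) v x‖ * ‖iteratedFDeriv ℝ (l - i) v x‖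
        ≤ (l.choose i : ℝ) * (A (i + 1) / ‖x‖ ^ (1 + (i + 1))) *
          (A (l - i) / ‖x‖ ^ (1 + (l - i))) := by gcongr
      _ = _ := by
        rw [show 2 + (l + 1) = (1 + (i + 1)) + (1 + (l - i)) by omega, pow_add _ (1 + (i + 1))]
        field_simp

/-- A function on the punctured space whose gradient decays like `‖x‖⁻³` converges at infinity
like `‖x‖⁻²`. -/
theorem exists_abs_sub_le_of_norm_fderiv_le {E : Type*} [NormedAddCommGroup E] [NormedSpace ℝ E]
    (hE : 1 < Module.rank ℝ E) {f : E → ℝ} (hf : ∀ x ≠ 0, DifferentiableAt ℝ f x) {C : ℝ}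
    (hC : 0 ≤ C) (hf' : ∀ x ≠ 0, ‖fderiv ℝ f x‖ ≤ C / ‖x‖ ^ 3) :
    ∃ c, ∀ x ≠ 0, |f x - c| ≤ 2 * C / ‖x‖ ^ 2 := by
  have hdouble : ∀ x ≠ 0, dist (f x) (f ((2 : ℝ) • x)) ≤ C / ‖x‖ ^ 2 := by
    intro x hx
    have hx0 := norm_pos_iff.2 hx
    have hseg : ∀ z ∈ segment ℝ x ((2 : ℝ) • x), ‖x‖ ≤ ‖z‖ := by
      rintro z ⟨a, b, ha, hb, hab, rfl⟩
      rw [smul_smul, ← add_smul, norm_smul, Real.norm_eq_abs, abs_of_nonneg (by positivity)]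
      nlinarith
    have hseg0 : ∀ z ∈ segment ℝ x ((2 : ℝ) • x), z ≠ 0 := fun z hz =>
      norm_pos_iff.1 (hx0.trans_le (hseg z hz))
    have := (convex_segment x ((2 : ℝ) • x)).norm_image_sub_le_of_norm_fderiv_le (𝕜 := ℝ) (f := f)
      (C := C / ‖x‖ ^ 3) (fun z hz => hf z (hseg0 z hz))
      (fun z hz => (hf' z (hseg0 z hz)).trans (by have := hseg z hz; gcongr))
      (right_mem_segment ℝ _ _) (left_mem_segment ℝ _ _)
    rw [dist_eq_norm]
    refine this.trans (le_of_eq ?_)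
    rw [show x - (2 : ℝ) • x = -x by rw [two_smul]; abel, norm_neg]
    field_simp
  have hpow : ∀ k : ℕ, (0 : ℝ) < 2 ^ k := fun k => by positivity
  have hne : ∀ x : E, x ≠ 0 → ∀ k : ℕ, (2 : ℝ) ^ k • x ≠ 0 := fun x hx k =>
    smul_ne_zero (hpow k).ne' hx
  have hgeom : ∀ x ≠ 0, ∀ k : ℕ, dist (f ((2 : ℝ) ^ k • x)) (f ((2 : ℝ) ^ (k + 1) • x)) ≤
      C / ‖x‖ ^ 2 * (1 / 4) ^ k := by
    intro x hx k
    have h1 := hdouble _ (hne x hx k)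
    rw [smul_smul, ← pow_succ'] at h1
    refine h1.trans (le_of_eq ?_)
    rw [norm_smul, Real.norm_eq_abs, abs_of_pos (hpow k), mul_pow, ← pow_mul, mul_comm k 2,
      pow_mul, div_pow, one_pow]
    norm_num
    field_simp
  have hlim : ∀ x, ∃ L, x ≠ 0 → Tendsto (fun k : ℕ => f ((2 : ℝ) ^ k • x)) atTop (𝓝 L) := by
    intro x
    by_cases hx : x = 0
    · exact ⟨0, fun h => absurd hx h⟩
    · obtain ⟨L, hL⟩ := cauchySeq_tendsto_of_complete
        (cauchySeq_of_le_geometric (1 / 4) _ (by norm_num) (hgeom x hx))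
      exact ⟨L, fun _ => hL⟩
  choose L hL using hlim
  have hfL : ∀ x ≠ 0, |f x - L x| ≤ 2 * C / ‖x‖ ^ 2 := by
    intro x hx
    have h1 := dist_le_of_le_geometric_of_tendsto₀ (1 / 4) _ (by norm_num) (hgeom x hx) (hL x hx)
    rw [pow_zero, one_smul, Real.dist_eq] at h1
    have h2 : 0 ≤ C / ‖x‖ ^ 2 := by positivity
    rw [mul_div_assoc]
    refine h1.trans ?_
    rw [div_le_iff₀ (by norm_num)]
    linarith
  have hloc : ∀ x ≠ 0, ∀ y ∈ ball x (‖x‖ / 2), L x = L y := by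
    intro x hx y hy
    have hx0 := norm_pos_iff.2 hx
    have hy0 : y ≠ 0 := norm_pos_iff.1 ((half_pos hx0).trans (half_norm_lt_norm hy))
    have hbd : ∀ k : ℕ, ‖f ((2 : ℝ) ^ k • x) - f ((2 : ℝ) ^ k • y)‖ ≤
        8 * C * ‖x - y‖ / ‖x‖ ^ 3 * (1 / 4) ^ k := by
      intro k
      have hk := hpow k
      set X := (2 : ℝ) ^ k • x
      set Y := (2 : ℝ) ^ k • y
      have hXn : ‖X‖ = 2 ^ k * ‖x‖ := by
        rw [norm_smul, Real.norm_eq_abs, abs_of_pos hk]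
      have hXY : ‖X - Y‖ = 2 ^ k * ‖x - y‖ := by
        rw [← smul_sub, norm_smul, Real.norm_eq_abs, abs_of_pos hk]
      have hX0 : 0 < ‖X‖ := by rw [hXn]; positivity
      have hYm : Y ∈ ball X (‖X‖ / 2) := by
        rw [mem_ball_iff_norm', hXY, hXn, mul_div_assoc]
        exact mul_lt_mul_of_pos_left (mem_ball_iff_norm'.1 hy) hk
      have hb : ∀ z ∈ ball X (‖X‖ / 2), z ≠ 0 := fun z hz =>
        norm_pos_iff.1 ((half_pos hX0).trans (half_norm_lt_norm hz))
      have := (convex_ball X (‖X‖ / 2)).norm_image_sub_le_of_norm_fderiv_le (𝕜 := ℝ) (f := f)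
        (C := C / (‖X‖ / 2) ^ 3) (fun z hz => hf z (hb z hz))
        (fun z hz => (hf' z (hb z hz)).trans (by have := (half_norm_lt_norm hz).le; gcongr))
        hYm (mem_ball_self (half_pos hX0))
      refine this.trans (le_of_eq ?_)
      have h4 : ((1 : ℝ) / 4) ^ k = 1 / (2 ^ k) ^ 2 := by
        rw [div_pow, one_pow, ← pow_mul, mul_comm k 2, pow_mul]
        norm_num
      rw [hXY, hXn, h4]
      field_simp
      ring
    have h0 : Tendsto (fun k : ℕ => f ((2 : ℝ) ^ k • x) - f ((2 : ℝ) ^ k • y)) atTop (𝓝 0) := by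
      refine squeeze_zero_norm hbd ?_
      simpa using (tendsto_pow_atTop_nhds_zero_of_lt_one (r := (1 / 4 : ℝ)) (by norm_num)
        (by norm_num)).const_mul (8 * C * ‖x - y‖ / ‖x‖ ^ 3)
    exact sub_eq_zero.1 (tendsto_nhds_unique ((hL x hx).sub (hL y hy0)) h0)
  have hconn : IsPreconnected ({0}ᶜ : Set E) :=
    (isConnected_compl_singleton_of_one_lt_rank hE 0).isPreconnected
  have hconst : ∀ x ≠ 0, ∀ y ≠ 0, L x = L y := fun x hx y hy =>
    hconn.induction₂ (fun x y => L x = L y)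
      (fun x hx => mem_nhdsWithin_of_mem_nhds <| by
        filter_upwards [ball_mem_nhds x (half_pos (norm_pos_iff.2 hx))] with y hy
        exact hloc x hx y hy)
      (fun _ _ _ _ _ _ h1 h2 => h1.trans h2) (fun _ _ _ _ h => h.symm) hx hy
  by_cases hex : ∃ x : E, x ≠ 0
  · obtain ⟨x₁, hx₁⟩ := hex
    exact ⟨L x₁, fun x hx => hconst x hx x₁ hx₁ ▸ hfL x hx⟩
  · exact ⟨0, fun x hx => absurd ⟨x, hx⟩ hex⟩

end Decay

end SteadyNS

/-- **Derivative and pressure estimates for steady Navier-Stokes solutions in ℝⁿ \ {0},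
n ≥ 4, with `|u| ≤ C/|x|`.**  For every `l ≥ 1` there is a constant `C_l` with
`|∇ˡu(x)| ≤ C_l/|x|^{1+l}` and `|∇ˡp(x)| ≤ C_l/|x|^{2+l}` for all `x ≠ 0`; moreover,
after subtracting a suitable constant `c`, `|p(x) - c| ≤ C₀/|x|²` for all `x ≠ 0`. -/
theorem steady_NS_derivative_estimates {n : ℕ} (hn : 4 ≤ n)
    (u : EuclideanSpace ℝ (Fin n) → EuclideanSpace ℝ (Fin n))
    (p : EuclideanSpace ℝ (Fin n) → ℝ)
    (hu : ContDiffOn ℝ (⊤ : ℕ∞) u {x : EuclideanSpace ℝ (Fin n) | x ≠ 0})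
    (hp : ContDiffOn ℝ (⊤ : ℕ∞) p {x : EuclideanSpace ℝ (Fin n) | x ≠ 0})
    (hNS : ∀ x : EuclideanSpace ℝ (Fin n), x ≠ 0 → ∀ j : Fin n,
      -(∑ i : Fin n, fderiv ℝ (fun y => fderiv ℝ (fun z => u z j) y
            (EuclideanSpace.single i 1)) x (EuclideanSpace.single i 1)) +
        (∑ i : Fin n, u x i * fderiv ℝ (fun z => u z j) x (EuclideanSpace.single i 1)) +
        fderiv ℝ p x (EuclideanSpace.single j 1) = 0)
    (hdiv : ∀ x : EuclideanSpace ℝ (Fin n), x ≠ 0 →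
      ∑ i : Fin n, fderiv ℝ (fun z => u z i) x (EuclideanSpace.single i 1) = 0)
    (C : ℝ) (hC : 0 < C)
    (hbound : ∀ x : EuclideanSpace ℝ (Fin n), x ≠ 0 → ‖u x‖ ≤ C / ‖x‖) :
    (∀ l : ℕ, 1 ≤ l → ∃ Cl : ℝ, 0 < Cl ∧
      ∀ x : EuclideanSpace ℝ (Fin n), x ≠ 0 →
        ‖iteratedFDeriv ℝ l u x‖ ≤ Cl / ‖x‖ ^ (1 + l) ∧
        ‖iteratedFDeriv ℝ l p x‖ ≤ Cl / ‖x‖ ^ (2 + l)) ∧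
    (∃ c C₀ : ℝ, 0 < C₀ ∧
      ∀ x : EuclideanSpace ℝ (Fin n), x ≠ 0 → |p x - c| ≤ C₀ / ‖x‖ ^ 2) := by
  have h : SteadyNS.SolvesNS u p {x | x ≠ 0} := by
    refine ⟨fun x hx j => ?_, fun x hx => hdiv x hx⟩
    have hj := hNS x hx j
    unfold SteadyNS.lap SteadyNS.dirDeriv
    linarith
  obtain ⟨hvel, hpres⟩ :=
    And.intro (SteadyNS.exists_norm_iteratedFDeriv_velocity_le hn h hu hp hC hbound)
      (SteadyNS.exists_norm_iteratedFDeriv_pressure_le hn h hu hp hC hbound)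
  refine ⟨fun l hl => ?_, ?_⟩
  · obtain ⟨A, hA, hAx⟩ := hvel l
    obtain ⟨B, hB, hBx⟩ := hpres (l - 1)
    rw [Nat.sub_add_cancel hl] at hBx
    refine ⟨max A B, lt_max_of_lt_left hA, fun x hx => ⟨(hAx x hx).trans ?_, (hBx x hx).trans ?_⟩⟩
    · gcongr
      exact le_max_left A B
    · gcongr
      exact le_max_right A B
  · obtain ⟨B, hB, hBx⟩ := hpres 0
    obtain ⟨c, hc⟩ := SteadyNS.exists_abs_sub_le_of_norm_fderiv_le (f := p) (C := B)
      (by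
        rw [rank_eq_card_basis (EuclideanSpace.basisFun (Fin n) ℝ).toBasis, Fintype.card_fin]
        exact_mod_cast (by omega : 1 < n))
      (fun x hx => (hp.contDiffAt (isOpen_ne.mem_nhds hx)).differentiableAt (by simp)) hB.le
      fun x hx => by simpa using hBx x hx
    exact ⟨c, 2 * B, by positivity, hc⟩
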